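/- arXiv:2007.10070 — 2 statements merged into one kernel-verified Lean document; each statement's English description precedes it below -/
import Mathlib

section
/- Let d ∈ ℕ, let Ω ⊊ ℝ^d be an interior (ε,δ)-corkscrew domain, let 1 ≤ p < ∞, 1 ≤ q ≤ ∞, 0 < σ < 1 and let 1 ≤ u ≤ ∞ satisfy σ > d/min(p,q) − d/u. Then there are constants c, C > 0, depending only on d, ε, δ, σ, p, q and u, such that for every measurable f : Ω → ℝ, c ( ‖f‖_{L^p(Ω)} + ‖f‖_{Ḟ^{σ,1}_{p,q,1}(Ω)} ) ≤ ‖f‖_{L^p(Ω)} + ‖f‖_{Ḟ^{σ,1}_{p,q,u}(Ω)} ≤ C ( ‖f‖_{L^p(Ω)} + ‖f‖_{Ḟ^{σ,1}_{p,q,1}(Ω)} ). -/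
open Set MeasureTheory ENNReal

noncomputable section

/-- `Ω` is an interior `(ε,δ)`-corkscrew domain: a nonempty open proper subset of
`ℝ^d` such that for every boundary point `z` and every radius `0 < r ≤ δ` there is a
ball `B(y, εr) ⊆ B(z,r) ∩ Ω`. -/
def IsCorkscrew (d : ℕ) (ε δ : ℝ) (Ω : Set (EuclideanSpace ℝ (Fin d))) : Prop :=
  IsOpen Ω ∧ Ω.Nonempty ∧ Ω ≠ Set.univ ∧
    ∀ z ∈ frontier Ω, ∀ r : ℝ, 0 < r → r ≤ δ →
      ∃ y : EuclideanSpace ℝ (Fin d), Metric.ball y (ε * r) ⊆ Metric.ball z r ∩ Ω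

/-- The inner quantity `t^{-σ-d/u} ( ∫_{B(x,t) ∩ U} |f(x)-f(y)|^u dy )^{1/u}`, with
the essential supremum over `y ∈ B(x,t) ∩ U` replacing the integral when `u = ∞`. -/
noncomputable def triebelInner (d : ℕ) (U : Set (EuclideanSpace ℝ (Fin d)))
    (f : EuclideanSpace ℝ (Fin d) → ℝ) (σ : ℝ) (u : ℝ≥0∞)
    (x : EuclideanSpace ℝ (Fin d)) (t : ℝ) : ℝ≥0∞ :=
  ENNReal.ofReal (t ^ (-(σ + (d : ℝ) / u.toReal))) *
    (if u = ⊤ then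
      essSup (fun y => ENNReal.ofReal |f x - f y|)
        (volume.restrict (Metric.ball x t ∩ U))
    else
      (∫⁻ y in Metric.ball x t ∩ U, ENNReal.ofReal |f x - f y| ^ u.toReal) ^
        (1 / u.toReal))

/-- The Triebel–Lizorkin-type seminorm `‖f‖_{Ḟ^{σ,ρ}_{p,q,u}(U)}`:
`( ∫_U ( ∫_0^ρ (t^{-σ-d/u} (∫_{U_{x,t}} |f(x)-f(y)|^u dy)^{1/u})^q dt/t )^{p/q} dx )^{1/p}`,
with the essential supremum over `t ∈ (0,ρ)` replacing the inner integral when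
`q = ∞` (and similarly in `y` when `u = ∞`). -/
noncomputable def triebelSeminorm (d : ℕ) (U : Set (EuclideanSpace ℝ (Fin d)))
    (f : EuclideanSpace ℝ (Fin d) → ℝ) (σ ρ p : ℝ) (q u : ℝ≥0∞) : ℝ≥0∞ :=
  (∫⁻ x in U,
      (if q = ⊤ then
        essSup (fun t => triebelInner d U f σ u x t)
          (volume.restrict (Set.Ioo (0 : ℝ) ρ))
      else
        (∫⁻ t in Set.Ioo (0 : ℝ) ρ,
            triebelInner d U f σ u x t ^ q.toReal * ENNReal.ofReal t⁻¹) ^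
          (1 / q.toReal)) ^ p) ^ (1 / p)

/-- The `L^p(U)` norm of `f` (as an extended nonnegative real). -/
noncomputable def lpNormOn (d : ℕ) (U : Set (EuclideanSpace ℝ (Fin d)))
    (f : EuclideanSpace ℝ (Fin d) → ℝ) (p : ℝ) : ℝ≥0∞ :=
  eLpNorm f (ENNReal.ofReal p) (volume.restrict U)

section MaximalFunction

variable {d : ℕ}

theorem volume_ball_eq (x : EuclideanSpace ℝ (Fin d)) {r : ℝ} (hr : 0 < r) :
    volume (Metric.ball x r) =
      ENNReal.ofReal r ^ d * volume (Metric.ball (0 : EuclideanSpace ℝ (Fin d)) 1) := by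
  rw [Measure.addHaar_ball_of_pos volume x hr, finrank_euclideanSpace_fin,
    ENNReal.ofReal_pow hr.le]

theorem volume_closedBall_eq (x : EuclideanSpace ℝ (Fin d)) {r : ℝ} (hr : 0 < r) :
    volume (Metric.closedBall x r) =
      ENNReal.ofReal r ^ d * volume (Metric.ball (0 : EuclideanSpace ℝ (Fin d)) 1) := by
  rw [Measure.addHaar_closedBall volume x hr.le, finrank_euclideanSpace_fin,
    ENNReal.ofReal_pow hr.le]

theorem volume_unit_ball_ne_zero :
    volume (Metric.ball (0 : EuclideanSpace ℝ (Fin d)) 1) ≠ 0 :=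
  (Metric.measure_ball_pos volume _ one_pos).ne'

theorem volume_unit_ball_ne_top :
    volume (Metric.ball (0 : EuclideanSpace ℝ (Fin d)) 1) ≠ ⊤ :=
  measure_ball_lt_top.ne

theorem measurable_setLIntegral_ball {α : Type*} [MeasurableSpace α]
    {h : α → EuclideanSpace ℝ (Fin d) → ℝ≥0∞} (hh : Measurable (Function.uncurry h))
    {c : α → EuclideanSpace ℝ (Fin d)} (hc : Measurable c) {r : α → ℝ} (hr : Measurable r) :
    Measurable fun a => ∫⁻ y in Metric.ball (c a) (r a), h a y := by
  have hS : MeasurableSet {z : α × EuclideanSpace ℝ (Fin d) | dist z.2 (c z.1) < r z.1} :=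
    measurableSet_lt (measurable_snd.dist (hc.comp measurable_fst)) (hr.comp measurable_fst)
  have := (hh.indicator hS).lintegral_prod_right' (ν := volume)
  convert this using 2 with a
  rw [← lintegral_indicator measurableSet_ball]
  rfl

/-- The dyadic maximal function over balls of radius at most `4`. -/
def localMaximal (h : EuclideanSpace ℝ (Fin d) → ℝ≥0∞) (x : EuclideanSpace ℝ (Fin d)) : ℝ≥0∞ :=
  ⨆ n : ℕ, (∫⁻ y in Metric.ball x (4 * 2⁻¹ ^ n), h y) / ENNReal.ofReal (4 * 2⁻¹ ^ n) ^ d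

theorem measurable_localMaximal {h : EuclideanSpace ℝ (Fin d) → ℝ≥0∞} (hh : Measurable h) :
    Measurable (localMaximal h) := by
  refine Measurable.iSup fun n => Measurable.div_const ?_ _
  exact measurable_setLIntegral_ball (h := fun _ y => h y) (hh.comp measurable_snd)
    measurable_id measurable_const

theorem average_le_localMaximal (h : EuclideanSpace ℝ (Fin d) → ℝ≥0∞)
    (x : EuclideanSpace ℝ (Fin d)) {t : ℝ} (ht0 : 0 < t) (ht1 : t ≤ 1) :
    (∫⁻ y in Metric.ball x (2 * t), h y) / ENNReal.ofReal t ^ d ≤ 8 ^ d * localMaximal h x := by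
  obtain ⟨n, hn1, hn2⟩ := exists_nat_pow_near_of_lt_one (x := t) (y := (2⁻¹ : ℝ)) ht0 ht1
    (by norm_num) (by norm_num)
  have hle : 2 * t ≤ 4 * 2⁻¹ ^ n := by nlinarith [pow_pos (show (0:ℝ) < 2⁻¹ by norm_num) n]
  have hge : 4 * 2⁻¹ ^ n ≤ 8 * t := by rw [pow_succ] at hn1; linarith
  have hM := le_iSup (fun n : ℕ => (∫⁻ y in Metric.ball x (4 * 2⁻¹ ^ n), h y) /
    ENNReal.ofReal (4 * 2⁻¹ ^ n) ^ d) n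
  have ht : ENNReal.ofReal t ^ d ≠ 0 := pow_ne_zero _ (by simpa using ht0)
  have ht' : ENNReal.ofReal t ^ d ≠ ⊤ := ENNReal.pow_ne_top ENNReal.ofReal_ne_top
  have hr : ENNReal.ofReal (4 * 2⁻¹ ^ n) ^ d ≤ 8 ^ d * ENNReal.ofReal t ^ d := by
    rw [← mul_pow]
    refine pow_le_pow_left₀ zero_le (a := ENNReal.ofReal (4 * 2⁻¹ ^ n)) ?_ d
    rw [← ENNReal.ofReal_ofNat, ← ENNReal.ofReal_mul (by norm_num)]
    exact ENNReal.ofReal_le_ofReal hge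
  rw [ENNReal.div_le_iff ht ht']
  have h0 : ENNReal.ofReal (4 * 2⁻¹ ^ n) ^ d ≠ 0 :=
    pow_ne_zero _ (by simp only [ne_eq, ENNReal.ofReal_eq_zero, not_le]; positivity)
  have h1 : ENNReal.ofReal (4 * 2⁻¹ ^ n) ^ d ≠ ⊤ := ENNReal.pow_ne_top ENNReal.ofReal_ne_top
  calc ∫⁻ y in Metric.ball x (2 * t), h y
      ≤ ∫⁻ y in Metric.ball x (4 * 2⁻¹ ^ n), h y :=
        lintegral_mono_set (Metric.ball_subset_ball hle)
    _ ≤ localMaximal h x * ENNReal.ofReal (4 * 2⁻¹ ^ n) ^ d :=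
        (ENNReal.div_le_iff h0 h1).1 hM
    _ ≤ localMaximal h x * (8 ^ d * ENNReal.ofReal t ^ d) := by gcongr
    _ = _ := by ring

theorem mul_measure_lt_localMaximal_le (h : EuclideanSpace ℝ (Fin d) → ℝ≥0∞) (l : ℝ≥0∞) :
    l * volume {x | l < localMaximal h x} ≤
      5 ^ d * volume (Metric.ball (0 : EuclideanSpace ℝ (Fin d)) 1) * ∫⁻ y, h y := by
  set v := volume (Metric.ball (0 : EuclideanSpace ℝ (Fin d)) 1)
  set A := {x | l < localMaximal h x}
  have hex : ∀ x : EuclideanSpace ℝ (Fin d), ∃ n : ℕ, x ∈ A →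
      l * ENNReal.ofReal (4 * 2⁻¹ ^ n) ^ d ≤ ∫⁻ y in Metric.ball x (4 * 2⁻¹ ^ n), h y := by
    intro x
    by_cases hx : x ∈ A
    · obtain ⟨n, hn⟩ := lt_iSup_iff.1 (show l < ⨆ n : ℕ, _ from hx)
      exact ⟨n, fun _ => (ENNReal.mul_lt_of_lt_div hn).le⟩
    · exact ⟨0, fun h => absurd h hx⟩
  choose n hn using hex
  have hr : ∀ x, 0 < 4 * (2⁻¹ : ℝ) ^ n x := fun x => by positivity
  obtain ⟨u, huA, hud, huc⟩ := Vitali.exists_disjoint_subfamily_covering_enlargement_closedBall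
    A id (fun x => 4 * (2⁻¹ : ℝ) ^ n x) 4
    (fun x _ => by
      have : (2⁻¹ : ℝ) ^ n x ≤ 1 := pow_le_one₀ (by norm_num) (by norm_num)
      linarith) 5 (by norm_num)
  have hcount : u.Countable := by
    refine hud.countable_of_nonempty_interior fun x _ => ?_
    refine ⟨x, ?_⟩
    exact mem_interior.2 ⟨_, Metric.ball_subset_closedBall, Metric.isOpen_ball,
      Metric.mem_ball_self (hr x)⟩
  have hcov : A ⊆ ⋃ b ∈ u, Metric.closedBall b (5 * (4 * (2⁻¹ : ℝ) ^ n b)) := by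
    intro a ha
    obtain ⟨b, hb, hab⟩ := huc a ha
    exact mem_biUnion hb (hab (Metric.mem_closedBall_self (hr a).le))
  have := hcount.to_subtype
  calc l * volume A ≤ l * ∑' b : u, volume (Metric.closedBall (b : EuclideanSpace ℝ (Fin d))
          (5 * (4 * (2⁻¹ : ℝ) ^ n b))) := by
        gcongr
        exact (measure_mono hcov).trans (measure_biUnion_le _ hcount _)
    _ = ∑' b : u, 5 ^ d * v * (l * ENNReal.ofReal (4 * (2⁻¹ : ℝ) ^ n b) ^ d) := by
        rw [← ENNReal.tsum_mul_left]
        congr 1 with b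
        rw [volume_closedBall_eq _ (mul_pos (by norm_num) (hr b)),
          ENNReal.ofReal_mul (by norm_num : (0:ℝ) ≤ 5), mul_pow]
        simp only [ENNReal.ofReal_ofNat]
        ring
    _ ≤ ∑' b : u, 5 ^ d * v * ∫⁻ y in Metric.ball (b : EuclideanSpace ℝ (Fin d))
          (4 * (2⁻¹ : ℝ) ^ n b), h y := by
        gcongr with b
        exact hn b (huA b.2)
    _ = 5 ^ d * v * ∫⁻ y in ⋃ b : u, Metric.ball (b : EuclideanSpace ℝ (Fin d))
          (4 * (2⁻¹ : ℝ) ^ n b), h y := by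
        rw [ENNReal.tsum_mul_left, lintegral_iUnion (fun _ => measurableSet_ball)]
        intro a b hab
        exact (hud a.2 b.2 (fun h => hab (Subtype.ext h))).mono Metric.ball_subset_closedBall
          Metric.ball_subset_closedBall
    _ ≤ _ := by gcongr; exact Measure.restrict_le_self

theorem lintegral_rpow_layer (a : ℝ≥0∞) {s : ℝ} (hs : 0 < s) :
    ∫⁻ l in Ioi (0 : ℝ), (if ENNReal.ofReal l < a then ENNReal.ofReal (s * l ^ (s - 1)) else 0) =
      a ^ s := by
  have key : ∀ N : ℝ, 0 ≤ N →
      ∫⁻ l in Ioo (0 : ℝ) N, ENNReal.ofReal (s * l ^ (s - 1)) = ENNReal.ofReal N ^ s := by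
    intro N hN
    rw [restrict_Ioo_eq_restrict_Ioc, ← ofReal_integral_eq_lintegral_ofReal,
      ← intervalIntegral.integral_of_le hN,
      intervalIntegral.integral_const_mul, integral_rpow (Or.inl (by linarith)),
      ENNReal.ofReal_rpow_of_nonneg hN hs.le]
    · congr 1
      rw [sub_add_cancel, Real.zero_rpow hs.ne']
      field_simp
      ring
    · refine Integrable.const_mul ?_ _
      exact (intervalIntegral.intervalIntegrable_rpow' (by linarith)).1
    · refine (ae_restrict_mem measurableSet_Ioc).mono fun l hl => ?_
      have := hl.1
      positivity
  by_cases ha : a = ⊤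
  · subst ha
    rw [ENNReal.top_rpow_of_pos hs]
    refine ENNReal.eq_top_of_forall_nnreal_le fun r => ?_
    have h1 := key ((r : ℝ) ^ s⁻¹) (by positivity)
    rw [ENNReal.ofReal_rpow_of_nonneg (by positivity) hs.le, Real.rpow_inv_rpow (by positivity) hs.ne',
      ENNReal.ofReal_coe_nnreal] at h1
    rw [← h1]
    simp only [ENNReal.ofReal_lt_top, if_true]
    exact lintegral_mono_set fun x hx => hx.1
  · obtain ⟨b, hb, rfl⟩ : ∃ b : ℝ, 0 ≤ b ∧ a = ENNReal.ofReal b :=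
      ⟨a.toReal, ENNReal.toReal_nonneg, (ENNReal.ofReal_toReal ha).symm⟩
    rw [← key b hb, ← lintegral_indicator measurableSet_Ioi,
      ← lintegral_indicator measurableSet_Ioo]
    congr 1 with l
    by_cases hl : 0 < l
    · by_cases hlb : l < b
      · simp [indicator, hl, hlb, ENNReal.ofReal_lt_ofReal_iff (hl.trans hlb)]
      · have : ¬ (ENNReal.ofReal l < ENNReal.ofReal b) := by
          rw [not_lt]; exact ENNReal.ofReal_le_ofReal (not_lt.1 hlb)
        simp [indicator, hlb, this]
    · simp [indicator, hl]

theorem lintegral_localMaximal_rpow_le (d : ℕ) {s : ℝ} (hs : 1 < s) :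
    ∃ C : ℝ≥0∞, C ≠ ⊤ ∧ ∀ h : EuclideanSpace ℝ (Fin d) → ℝ≥0∞, Measurable h →
      ∫⁻ x, localMaximal h x ^ s ≤ C * ∫⁻ x, h x ^ s := by
  set v := volume (Metric.ball (0 : EuclideanSpace ℝ (Fin d)) 1) with hv
  have hv0 : v ≠ 0 := volume_unit_ball_ne_zero
  have hvt : v ≠ ⊤ := volume_unit_ball_ne_top
  have hc0 : 2 * v ≠ 0 := mul_ne_zero two_ne_zero hv0
  have hct : 2 * v ≠ ⊤ := ENNReal.mul_ne_top (by norm_num) hvt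
  have hs0 : 0 < s := by linarith
  have hs1 : 0 < s - 1 := by linarith
  set k := ENNReal.ofReal (s / (s - 1))
  refine ⟨(2 * v) ^ s * (5 ^ d * k), ENNReal.mul_ne_top (ENNReal.rpow_ne_top_of_nonneg hs0.le hct)
    (ENNReal.mul_ne_top (ENNReal.pow_ne_top (by norm_num)) ENNReal.ofReal_ne_top), ?_⟩
  intro h hh
  have hMm := measurable_localMaximal hh
  have hsplit : ∀ l : ℝ≥0∞, l ≠ ⊤ → ∀ x, l < localMaximal h x / (2 * v) →
      v * l < localMaximal ({z | l < h z}.indicator h) x := by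
    intro l hl x hx
    have h1 : 2 * v * l < localMaximal h x := by
      rw [mul_comm]; exact ENNReal.mul_lt_of_lt_div hx
    have h2 : localMaximal h x ≤ localMaximal ({z | l < h z}.indicator h) x + v * l := by
      refine iSup_le fun n => ?_
      have hr : 0 < 4 * (2⁻¹ : ℝ) ^ n := by positivity
      have h0 : ENNReal.ofReal (4 * 2⁻¹ ^ n) ^ d ≠ 0 :=
        pow_ne_zero _ (by simpa only [ne_eq, ENNReal.ofReal_eq_zero, not_le])
      have h1 : ENNReal.ofReal (4 * 2⁻¹ ^ n) ^ d ≠ ⊤ := ENNReal.pow_ne_top ENNReal.ofReal_ne_top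
      calc (∫⁻ y in Metric.ball x (4 * 2⁻¹ ^ n), h y) / ENNReal.ofReal (4 * 2⁻¹ ^ n) ^ d
          ≤ (∫⁻ y in Metric.ball x (4 * 2⁻¹ ^ n), ({z | l < h z}.indicator h y + l)) /
              ENNReal.ofReal (4 * 2⁻¹ ^ n) ^ d := by
            gcongr with y
            by_cases hy : l < h y
            · simp [indicator, hy]
            · simpa [indicator, hy] using not_lt.1 hy
        _ = (∫⁻ y in Metric.ball x (4 * 2⁻¹ ^ n), {z | l < h z}.indicator h y) /
              ENNReal.ofReal (4 * 2⁻¹ ^ n) ^ d + v * l := by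
            rw [lintegral_add_right _ measurable_const, setLIntegral_const,
              volume_ball_eq x hr, ENNReal.add_div, ← hv]
            congr 1
            rw [mul_comm l, mul_assoc, ENNReal.mul_div_right_comm, ENNReal.div_self h0 h1, one_mul]
        _ ≤ _ := by
            gcongr
            exact le_iSup (fun n : ℕ => (∫⁻ y in Metric.ball x (4 * 2⁻¹ ^ n),
              {z | l < h z}.indicator h y) / ENNReal.ofReal (4 * 2⁻¹ ^ n) ^ d) n
    have h3 : v * l + v * l < localMaximal ({z | l < h z}.indicator h) x + v * l := by
      calc v * l + v * l = 2 * v * l := by ring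
        _ < _ := h1.trans_le h2
    exact lt_of_add_lt_add_right h3
  have hmeas1 : Measurable fun z : EuclideanSpace ℝ (Fin d) × ℝ =>
      if ENNReal.ofReal z.2 < localMaximal h z.1 / (2 * v) then
        ENNReal.ofReal (s * z.2 ^ (s - 1)) else 0 := by
    refine Measurable.ite (measurableSet_lt (by fun_prop) ?_) (by fun_prop) measurable_const
    exact (hMm.comp measurable_fst).div_const _
  have hmeas2 : Measurable fun z : EuclideanSpace ℝ (Fin d) × ℝ =>
      if ENNReal.ofReal z.2 < h z.1 then
        ENNReal.ofReal ((s - 1) * z.2 ^ (s - 1 - 1)) else 0 := by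
    refine Measurable.ite (measurableSet_lt (by fun_prop) (by fun_prop)) (by fun_prop)
      measurable_const
  calc ∫⁻ x, localMaximal h x ^ s
      = ∫⁻ x, (2 * v) ^ s * (localMaximal h x / (2 * v)) ^ s := by
        congr 1 with x
        rw [← ENNReal.mul_rpow_of_nonneg _ _ hs0.le, ENNReal.mul_div_cancel hc0 hct]
    _ = (2 * v) ^ s * ∫⁻ x, (localMaximal h x / (2 * v)) ^ s :=
        lintegral_const_mul _ ((hMm.div_const _).pow_const _)
    _ = (2 * v) ^ s * ∫⁻ x, ∫⁻ l in Ioi (0 : ℝ),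
          (if ENNReal.ofReal l < localMaximal h x / (2 * v) then
            ENNReal.ofReal (s * l ^ (s - 1)) else 0) := by
        congr 2 with x
        rw [lintegral_rpow_layer _ hs0]
    _ = (2 * v) ^ s * ∫⁻ l in Ioi (0 : ℝ), ∫⁻ x,
          (if ENNReal.ofReal l < localMaximal h x / (2 * v) then
            ENNReal.ofReal (s * l ^ (s - 1)) else 0) := by
        rw [lintegral_lintegral_swap hmeas1.aemeasurable]
    _ ≤ (2 * v) ^ s * ∫⁻ l in Ioi (0 : ℝ), ∫⁻ x, 5 ^ d * k * (h x *
          (if ENNReal.ofReal l < h x then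
            ENNReal.ofReal ((s - 1) * l ^ (s - 1 - 1)) else 0)) := by
        gcongr (2 * v) ^ s * ?_
        refine setLIntegral_mono' measurableSet_Ioi fun l hl => ?_
        have hl : 0 < l := hl
        have hl0 : ENNReal.ofReal l ≠ 0 := by simpa using hl
        have hlt : ENNReal.ofReal l ≠ ⊤ := ENNReal.ofReal_ne_top
        set w := ENNReal.ofReal (s * l ^ (s - 1)) with hw
        set w' := ENNReal.ofReal ((s - 1) * l ^ (s - 1 - 1)) with hw'
        have hww : w = k * w' * ENNReal.ofReal l := by
          rw [hw, hw', ← ENNReal.ofReal_mul (by positivity), ← ENNReal.ofReal_mul (by positivity)]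
          congr 1
          rw [Real.rpow_sub_one hl.ne' (s - 1)]
          field_simp
        have hA : MeasurableSet {x | ENNReal.ofReal l < h x} := measurableSet_lt measurable_const hh
        have hweak := mul_measure_lt_localMaximal_le
          ({z | ENNReal.ofReal l < h z}.indicator h) (v * ENNReal.ofReal l)
        rw [← hv, mul_assoc, mul_comm (5 ^ d) v, mul_assoc, ENNReal.mul_le_mul_iff_right hv0 hvt]
          at hweak
        calc ∫⁻ x, (if ENNReal.ofReal l < localMaximal h x / (2 * v) then w else 0)
            = w * volume {x | ENNReal.ofReal l < localMaximal h x / (2 * v)} := by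
              rw [← lintegral_indicator_const
                (measurableSet_lt measurable_const (hMm.div_const _))]
              simp [indicator]
          _ ≤ w * volume {x | v * ENNReal.ofReal l <
                localMaximal ({z | ENNReal.ofReal l < h z}.indicator h) x} := by
              gcongr w * ?_
              exact measure_mono fun x => hsplit _ hlt x
          _ = k * w' * (ENNReal.ofReal l * volume {x | v * ENNReal.ofReal l <
                localMaximal ({z | ENNReal.ofReal l < h z}.indicator h) x}) := by
              rw [hww]; ring
          _ ≤ k * w' * (5 ^ d * ∫⁻ x, {z | ENNReal.ofReal l < h z}.indicator h x) := by
              gcongr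
          _ = ∫⁻ x, 5 ^ d * k * w' * {z | ENNReal.ofReal l < h z}.indicator h x := by
              rw [lintegral_const_mul _ (hh.indicator hA)]; ring
          _ = _ := by
              congr 1 with x
              by_cases hx : ENNReal.ofReal l < h x
              · simp only [indicator, mem_ofPred_eq, hx, if_true]; ring
              · simp [indicator, hx]
    _ = (2 * v) ^ s * ∫⁻ x, ∫⁻ l in Ioi (0 : ℝ), 5 ^ d * k * (h x *
          (if ENNReal.ofReal l < h x then
            ENNReal.ofReal ((s - 1) * l ^ (s - 1 - 1)) else 0)) := by
        rw [lintegral_lintegral_swap]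
        exact ((((hh.comp measurable_fst).mul hmeas2).const_mul (5 ^ d * k)).comp
          measurable_swap).aemeasurable
    _ = (2 * v) ^ s * ∫⁻ x, 5 ^ d * k * h x ^ s := by
        congr 2 with x
        have hm : Measurable fun l : ℝ => if ENNReal.ofReal l < h x then
            ENNReal.ofReal ((s - 1) * l ^ (s - 1 - 1)) else 0 := hmeas2.comp measurable_prodMk_left
        rw [lintegral_const_mul _ (hm.const_mul _), lintegral_const_mul _ hm,
          lintegral_rpow_layer _ hs1]
        congr 1
        nth_rw 1 [← ENNReal.rpow_one (h x)]
        rw [← ENNReal.rpow_add_of_nonneg _ _ zero_le_one hs1.le]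
        congr 1; ring
    _ = _ := by
        rw [lintegral_const_mul _ (hh.pow_const _)]; ring

end MaximalFunction

section BallAverage

variable {d : ℕ}

/-- The integral of `h` over `B(x, 2t)`, normalised by `t ^ d`. -/
def ballAverage (h : EuclideanSpace ℝ (Fin d) → ℝ≥0∞) (x : EuclideanSpace ℝ (Fin d)) (t : ℝ) :
    ℝ≥0∞ :=
  (∫⁻ y in Metric.ball x (2 * t), h y) / ENNReal.ofReal t ^ d

theorem measurable_ballAverage {g : EuclideanSpace ℝ (Fin d) → ℝ → ℝ≥0∞}
    (hg : Measurable (Function.uncurry g)) :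
    Measurable (Function.uncurry fun x t => ballAverage (fun y => g y t) x t) := by
  refine Measurable.div ?_ (by fun_prop)
  refine measurable_setLIntegral_ball
    (α := EuclideanSpace ℝ (Fin d) × ℝ) (h := fun z y => g y z.2) ?_ measurable_fst (by fun_prop)
  exact hg.comp (measurable_snd.prodMk (measurable_snd.comp measurable_fst))

theorem measurable_ballAverage_left {h : EuclideanSpace ℝ (Fin d) → ℝ≥0∞}
    (hh : Measurable h) (t : ℝ) : Measurable fun x => ballAverage h x t :=
  (measurable_setLIntegral_ball (h := fun _ y => h y) (hh.comp measurable_snd) measurable_id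
    measurable_const).div_const _

theorem lintegral_ballAverage_mul {w h : EuclideanSpace ℝ (Fin d) → ℝ≥0∞}
    (hw : Measurable w) (hh : Measurable h) (t : ℝ) :
    ∫⁻ x, ballAverage w x t * h x = ∫⁻ y, w y * ballAverage h y t := by
  have hS : MeasurableSet {z : EuclideanSpace ℝ (Fin d) × EuclideanSpace ℝ (Fin d) |
      dist z.2 z.1 < 2 * t} :=
    measurableSet_lt (measurable_snd.dist measurable_fst) measurable_const
  have h1 : ∀ w h : EuclideanSpace ℝ (Fin d) → ℝ≥0∞, Measurable w → Measurable h → 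
      ∀ x, ballAverage w x t * h x =
      ∫⁻ y, {z : EuclideanSpace ℝ (Fin d) × EuclideanSpace ℝ (Fin d) |
        dist z.2 z.1 < 2 * t}.indicator (fun z => w z.2 * h z.1 * (ENNReal.ofReal t ^ d)⁻¹)
          (x, y) := by
    intro w h hw hh x
    rw [ballAverage, div_eq_mul_inv, mul_assoc, ← lintegral_mul_const _ hw,
      ← lintegral_indicator measurableSet_ball]
    congr 1 with y
    simp only [indicator, Metric.mem_ball, mem_ofPred_eq]
    split_ifs <;> ring
  simp_rw [mul_comm (w _)]
  simp_rw [h1 w h hw hh, h1 h w hh hw]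
  rw [lintegral_lintegral_swap]
  · congr 1 with y
    congr 1 with x
    simp only [indicator, mem_ofPred_eq, dist_comm x y]
    split_ifs <;> ring
  · refine (Measurable.indicator ?_ hS).aemeasurable
    exact ((hw.comp measurable_snd).mul (hh.comp measurable_fst)).mul_const _

theorem ballAverage_one (x : EuclideanSpace ℝ (Fin d)) {t : ℝ} (ht : 0 < t) :
    ballAverage (fun _ => 1) x t =
      2 ^ d * volume (Metric.ball (0 : EuclideanSpace ℝ (Fin d)) 1) := by
  have ht0 : ENNReal.ofReal t ^ d ≠ 0 := pow_ne_zero _ (by simpa using ht)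
  have ht' : ENNReal.ofReal t ^ d ≠ ⊤ := ENNReal.pow_ne_top ENNReal.ofReal_ne_top
  rw [ballAverage, setLIntegral_const, one_mul, volume_ball_eq x (by positivity),
    ENNReal.ofReal_mul (by norm_num), mul_pow, mul_right_comm, mul_div_assoc,
    ENNReal.div_self ht0 ht', mul_one, ENNReal.ofReal_ofNat]

theorem lintegral_ballAverage {w : EuclideanSpace ℝ (Fin d) → ℝ≥0∞}
    (hw : Measurable w) {t : ℝ} (ht : 0 < t) :
    ∫⁻ x, ballAverage w x t =
      2 ^ d * volume (Metric.ball (0 : EuclideanSpace ℝ (Fin d)) 1) * ∫⁻ y, w y := by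
  have := lintegral_ballAverage_mul hw (h := fun _ => 1) measurable_const t
  simp only [ballAverage_one _ ht, mul_one] at this
  rw [this, lintegral_mul_const _ hw, mul_comm]

theorem ballAverage_mono_ae {w h : EuclideanSpace ℝ (Fin d) → ℝ≥0∞} (hwh : w ≤ᵐ[volume] h)
    (x : EuclideanSpace ℝ (Fin d)) (t : ℝ) : ballAverage w x t ≤ ballAverage h x t := by
  unfold ballAverage
  gcongr ?_ / _
  exact lintegral_mono_ae (ae_restrict_of_ae hwh)

theorem ballAverage_mul_le {Q Q' : ℝ} (hQ : Q.HolderConjugate Q')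
    {w h : EuclideanSpace ℝ (Fin d) → ℝ≥0∞} (hw : Measurable w) (hh : Measurable h)
    (x : EuclideanSpace ℝ (Fin d)) (t : ℝ) :
    ballAverage (fun y => w y * h y) x t ≤
      ballAverage (fun y => w y ^ Q) x t ^ (1 / Q) *
        ballAverage (fun y => h y ^ Q') x t ^ (1 / Q') := by
  unfold ballAverage
  have h0 : 0 ≤ 1 / Q := hQ.one_div_nonneg
  have h0' : 0 ≤ 1 / Q' := hQ.symm.one_div_nonneg
  have hsum : 1 / Q + 1 / Q' = 1 := by
    rw [one_div, one_div]; exact hQ.inv_add_inv_eq_one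
  calc _ ≤ ((∫⁻ y in Metric.ball x (2 * t), w y ^ Q) ^ (1 / Q) *
        (∫⁻ y in Metric.ball x (2 * t), h y ^ Q') ^ (1 / Q')) / ENNReal.ofReal t ^ d := by
        gcongr
        exact ENNReal.lintegral_mul_le_Lp_mul_Lq _ hQ hw.aemeasurable hh.aemeasurable
    _ = _ := by
        simp only [ENNReal.div_eq_inv_mul (b := ENNReal.ofReal t ^ d)]
        rw [ENNReal.mul_rpow_of_nonneg _ _ h0,
          ENNReal.mul_rpow_of_nonneg _ _ h0',
          mul_mul_mul_comm (_ ^ (1 / Q)),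
          ← ENNReal.rpow_add_of_nonneg _ _ h0 h0', hsum, ENNReal.rpow_one]

theorem ballAverage_rpow_le {Q : ℝ} (hQ : 1 < Q)
    {w : EuclideanSpace ℝ (Fin d) → ℝ≥0∞} (hw : Measurable w)
    (x : EuclideanSpace ℝ (Fin d)) {t : ℝ} (ht : 0 < t) :
    ballAverage w x t ^ Q ≤
      (2 ^ d * volume (Metric.ball (0 : EuclideanSpace ℝ (Fin d)) 1)) ^ (Q - 1) *
        ballAverage (fun y => w y ^ Q) x t := by
  have hc := Real.HolderConjugate.conjExponent hQ
  have := ballAverage_mul_le hc hw (h := fun _ => 1) measurable_const x t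
  simp only [mul_one, ENNReal.one_rpow, ballAverage_one _ ht] at this
  refine (ENNReal.rpow_le_rpow this hc.nonneg).trans_eq ?_
  rw [ENNReal.mul_rpow_of_nonneg _ _ hc.nonneg, ← ENNReal.rpow_mul, ← ENNReal.rpow_mul,
    one_div_mul_cancel hc.ne_zero, ENNReal.rpow_one, mul_comm]
  congr 2
  rw [Real.conjExponent]
  have : Q - 1 ≠ 0 := by linarith
  have : Q ≠ 0 := by linarith
  field_simp

theorem lintegral_rpow_le_of_forall_lintegral_mul_le {α : Type*} [MeasurableSpace α]
    {μ : Measure α} [SigmaFinite μ] {S S' : ℝ} (hS : S.HolderConjugate S')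
    {F : α → ℝ≥0∞} (hF : Measurable F) {K : ℝ≥0∞}
    (hK : ∀ h : α → ℝ≥0∞, Measurable h → ∫⁻ x, F x * h x ∂μ ≤ K * (∫⁻ x, h x ^ S' ∂μ) ^ (1 / S')) :
    ∫⁻ x, F x ^ S ∂μ ≤ K ^ S := by
  have hS1 := hS.lt
  have hS0 : 0 < S := hS.pos
  set A : ℕ → α → ℝ≥0∞ := fun n => (spanningSets μ n).indicator fun x => min (F x) n
  have hA : ∀ n, Measurable (A n) := fun n =>
    (hF.min measurable_const).indicator (measurableSet_spanningSets μ n)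
  have hAF : ∀ n x, A n x ≤ F x := fun n x => by
    by_cases hx : x ∈ spanningSets μ n <;> simp [A, hx]
  have hmono : Monotone A := by
    intro m n hmn x
    by_cases hx : x ∈ spanningSets μ m
    · have hx' := monotone_spanningSets μ hmn hx
      simp only [A, indicator_of_mem hx, indicator_of_mem hx']
      gcongr
    · simp [A, hx]
  have hsup : ∀ x, ⨆ n, A n x ^ S = F x ^ S := by
    intro x
    have h1 : ⨆ n, A n x = F x := by
      refine le_antisymm (iSup_le fun n => hAF n x) ?_
      refine le_of_forall_lt fun b hb => ?_
      obtain ⟨m, hm⟩ := ENNReal.exists_nat_gt hb.ne_top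
      have hx := mem_spanningSetsIndex μ x
      refine lt_iSup_iff.2 ⟨max m (spanningSetsIndex μ x), ?_⟩
      have hx' := monotone_spanningSets μ (le_max_right m (spanningSetsIndex μ x)) hx
      simp only [A, indicator_of_mem hx']
      refine lt_min hb (hm.trans_le ?_)
      exact_mod_cast le_max_left _ _
    have := (ENNReal.orderIsoRpow S hS0).map_iSup (fun n => A n x)
    simp only [ENNReal.orderIsoRpow_apply] at this
    rw [← this, h1]
  calc ∫⁻ x, F x ^ S ∂μ = ∫⁻ x, ⨆ n, A n x ^ S ∂μ := by simp_rw [hsup]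
    _ = ⨆ n, ∫⁻ x, A n x ^ S ∂μ := lintegral_iSup (fun n => (hA n).pow_const _)
        (fun m n hmn x => ENNReal.rpow_le_rpow (hmono hmn x) hS0.le)
    _ ≤ K ^ S := by
      refine iSup_le fun n => ?_
      set X := ∫⁻ x, A n x ^ S ∂μ with hX
      have hXt : X ≠ ⊤ := by
        have : X ≤ ∫⁻ x, (spanningSets μ n).indicator (fun _ => (n : ℝ≥0∞) ^ S) x ∂μ := by
          refine lintegral_mono fun x => ?_
          by_cases hx : x ∈ spanningSets μ n
          · simp only [A, indicator_of_mem hx]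
            gcongr
            exact min_le_right _ _
          · simp [A, hx, hS0]
        refine (this.trans_lt ?_).ne
        rw [lintegral_indicator_const (measurableSet_spanningSets μ n)]
        exact ENNReal.mul_lt_top
          (ENNReal.rpow_lt_top_of_nonneg hS0.le (ENNReal.natCast_ne_top n))
          (measure_spanningSets_lt_top μ n)
      have hle : X ≤ K * X ^ (1 / S') := by
        calc X ≤ ∫⁻ x, F x * A n x ^ (S - 1) ∂μ := by
              refine lintegral_mono fun x => ?_
              calc A n x ^ S = A n x ^ (1 : ℝ) * A n x ^ (S - 1) := by
                    rw [← ENNReal.rpow_add_of_nonneg _ _ zero_le_one (by linarith)]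
                    congr 1; ring
                _ ≤ _ := by
                    rw [ENNReal.rpow_one]; gcongr; exact hAF n x
          _ ≤ _ := hK _ ((hA n).pow_const _)
          _ = _ := by
              congr 3 with x
              rw [← ENNReal.rpow_mul, hS.sub_one_mul_conj]
      by_cases hX0 : X = 0
      · simp [hX0]
      have hX' : X ^ (1 / S) * X ^ (1 / S') = X := by
        rw [← ENNReal.rpow_add_of_nonneg _ _ hS.one_div_nonneg hS.symm.one_div_nonneg, one_div,
          one_div, hS.inv_add_inv_eq_one, ENNReal.rpow_one]
      have h2 : X ^ (1 / S) ≤ K := by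
        refine (ENNReal.mul_le_mul_iff_left (c := X ^ (1 / S')) ?_ ?_).1 (hX'.trans_le hle)
        · exact (ENNReal.rpow_pos (pos_iff_ne_zero.2 hX0) hXt).ne'
        · exact ENNReal.rpow_ne_top_of_nonneg hS.symm.one_div_nonneg hXt
      calc X = (X ^ (1 / S)) ^ S := by
            rw [← ENNReal.rpow_mul, one_div_mul_cancel hS0.ne', ENNReal.rpow_one]
        _ ≤ K ^ S := by gcongr

end BallAverage

section VectorValued

variable {d : ℕ}

theorem lintegral_lintegral_swap_of_measurable {α β : Type*} [MeasurableSpace α]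
    [MeasurableSpace β] {μ : Measure α} {ν : Measure β} [SFinite μ] [SFinite ν]
    {F : α → β → ℝ≥0∞} (hF : Measurable (Function.uncurry F)) :
    ∫⁻ x, (∫⁻ t, F x t ∂ν) ∂μ = ∫⁻ t, (∫⁻ x, F x t ∂μ) ∂ν :=
  lintegral_lintegral_swap hF.aemeasurable

theorem vectorValued_ballAverage_le_of_eq (d : ℕ) {Q : ℝ} (hQ : 1 < Q) :
    ∃ C : ℝ≥0∞, C ≠ ⊤ ∧ ∀ (ν : Measure ℝ) [SFinite ν], (∀ᵐ t ∂ν, t ∈ Ioo (0 : ℝ) 1) →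
      ∀ g : EuclideanSpace ℝ (Fin d) → ℝ → ℝ≥0∞, Measurable (Function.uncurry g) →
        ∫⁻ x, ∫⁻ t, ballAverage (fun y => g y t) x t ^ Q ∂ν ≤
          C * ∫⁻ x, ∫⁻ t, g x t ^ Q ∂ν := by
  set c := 2 ^ d * volume (Metric.ball (0 : EuclideanSpace ℝ (Fin d)) 1) with hc
  have hct : c ≠ ⊤ := ENNReal.mul_ne_top (ENNReal.pow_ne_top (by norm_num)) volume_unit_ball_ne_top
  refine ⟨c ^ (Q - 1) * c, ENNReal.mul_ne_top
    (ENNReal.rpow_ne_top_of_nonneg (by linarith) hct) hct, ?_⟩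
  intro ν _ hν g hg
  have hgt : ∀ t, Measurable fun y => g y t := fun t => hg.comp measurable_prodMk_right
  have hgQ : Measurable (Function.uncurry fun x t => g x t ^ Q) := hg.pow_const Q
  have hBQ : Measurable (Function.uncurry fun x t => ballAverage (fun y => g y t) x t ^ Q) :=
    (measurable_ballAverage hg).pow_const Q
  rw [lintegral_lintegral_swap_of_measurable hBQ, lintegral_lintegral_swap_of_measurable hgQ,
    ← lintegral_const_mul _ hgQ.lintegral_prod_left]
  refine lintegral_mono_ae (hν.mono fun t ht => ?_)
  calc ∫⁻ x, ballAverage (fun y => g y t) x t ^ Q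
      ≤ ∫⁻ x, c ^ (Q - 1) * ballAverage (fun y => g y t ^ Q) x t :=
        lintegral_mono fun x => ballAverage_rpow_le hQ (hgt t) x ht.1
    _ = _ := by
        rw [lintegral_const_mul _ (measurable_ballAverage_left ((hgt t).pow_const Q) t),
          lintegral_ballAverage ((hgt t).pow_const Q) ht.1, ← mul_assoc]

theorem vectorValued_ballAverage_le_of_lt (d : ℕ) {P Q : ℝ} (hQ : 1 < Q) (hQP : Q < P) :
    ∃ C : ℝ≥0∞, C ≠ ⊤ ∧ ∀ (ν : Measure ℝ) [SFinite ν], (∀ᵐ t ∂ν, t ∈ Ioo (0 : ℝ) 1) →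
      ∀ g : EuclideanSpace ℝ (Fin d) → ℝ → ℝ≥0∞, Measurable (Function.uncurry g) →
        ∫⁻ x, (∫⁻ t, ballAverage (fun y => g y t) x t ^ Q ∂ν) ^ (P / Q) ≤
          C * ∫⁻ x, (∫⁻ t, g x t ^ Q ∂ν) ^ (P / Q) := by
  set c := 2 ^ d * volume (Metric.ball (0 : EuclideanSpace ℝ (Fin d)) 1) with hc
  have hct : c ≠ ⊤ := ENNReal.mul_ne_top (ENNReal.pow_ne_top (by norm_num)) volume_unit_ball_ne_top
  have hQ0 : 0 < Q := by linarith
  have hS : (P / Q).HolderConjugate (P / Q).conjExponent :=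
    Real.HolderConjugate.conjExponent (by rwa [one_lt_div hQ0])
  set S := P / Q
  set S' := S.conjExponent
  obtain ⟨CM, hCM, hM⟩ := lintegral_localMaximal_rpow_le d hS.symm.lt
  refine ⟨(c ^ (Q - 1) * 8 ^ d * CM ^ (1 / S')) ^ S, ?_, ?_⟩
  · refine ENNReal.rpow_ne_top_of_nonneg hS.nonneg (ENNReal.mul_ne_top (ENNReal.mul_ne_top
      (ENNReal.rpow_ne_top_of_nonneg (by linarith) hct) (ENNReal.pow_ne_top (by norm_num)))
      (ENNReal.rpow_ne_top_of_nonneg hS.symm.one_div_nonneg hCM))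
  intro ν _ hν g hg
  have hgt : ∀ t, Measurable fun y => g y t := fun t => hg.comp measurable_prodMk_right
  have hgQ : Measurable (Function.uncurry fun x t => g x t ^ Q) := hg.pow_const Q
  have hG : Measurable fun x => ∫⁻ t, g x t ^ Q ∂ν := hgQ.lintegral_prod_right
  have hB : Measurable (Function.uncurry fun x t => ballAverage (fun y => g y t) x t ^ Q) :=
    (measurable_ballAverage hg).pow_const Q
  have hBQ : Measurable (Function.uncurry fun x t => ballAverage (fun y => g y t ^ Q) x t) :=
    measurable_ballAverage hgQ
  have hBm : Measurable fun x => ∫⁻ t, ballAverage (fun y => g y t) x t ^ Q ∂ν :=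
    hB.lintegral_prod_right
  set I := ∫⁻ x, (∫⁻ t, g x t ^ Q ∂ν) ^ S
  have hfin : (c ^ (Q - 1) * 8 ^ d * CM ^ (1 / S') * I ^ (1 / S)) ^ S =
      (c ^ (Q - 1) * 8 ^ d * CM ^ (1 / S')) ^ S * I := by
    rw [ENNReal.mul_rpow_of_nonneg _ _ hS.nonneg, ← ENNReal.rpow_mul (x := I),
      one_div_mul_cancel hS.ne_zero, ENNReal.rpow_one]
  rw [← hfin]
  refine lintegral_rpow_le_of_forall_lintegral_mul_le hS hBm fun h hh => ?_
  have hhM := measurable_localMaximal hh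
  have hF1 : Measurable (Function.uncurry fun x t =>
      c ^ (Q - 1) * (ballAverage (fun y => g y t ^ Q) x t * h x)) :=
    (hBQ.mul (hh.comp measurable_fst)).const_mul (c ^ (Q - 1))
  have hF2 : Measurable (Function.uncurry fun x t =>
      c ^ (Q - 1) * 8 ^ d * (g x t ^ Q * localMaximal h x)) :=
    (hgQ.mul (hhM.comp measurable_fst)).const_mul (c ^ (Q - 1) * 8 ^ d)
  calc ∫⁻ x, (∫⁻ t, ballAverage (fun y => g y t) x t ^ Q ∂ν) * h x
      ≤ ∫⁻ x, (∫⁻ t, c ^ (Q - 1) * (ballAverage (fun y => g y t ^ Q) x t * h x) ∂ν) := by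
        refine lintegral_mono fun x => ?_
        have hBx : Measurable fun t => ballAverage (fun y => g y t) x t ^ Q :=
          hB.of_uncurry_left
        rw [← lintegral_mul_const _ hBx]
        refine lintegral_mono_ae (hν.mono fun t ht => ?_)
        rw [← mul_assoc]
        gcongr
        exact ballAverage_rpow_le hQ (hgt t) x ht.1
    _ = ∫⁻ t, (c ^ (Q - 1) * ∫⁻ x, g x t ^ Q * ballAverage h x t) ∂ν := by
        rw [lintegral_lintegral_swap_of_measurable hF1]
        refine lintegral_congr fun t => ?_
        have hm1 : Measurable fun x => ballAverage (fun y => g y t ^ Q) x t * h x :=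
          (measurable_ballAverage_left ((hgt t).pow_const Q) t).mul hh
        rw [lintegral_const_mul _ hm1,
          lintegral_ballAverage_mul ((hgt t).pow_const Q) hh]
    _ ≤ ∫⁻ t, (∫⁻ x, c ^ (Q - 1) * 8 ^ d * (g x t ^ Q * localMaximal h x)) ∂ν := by
        refine lintegral_mono_ae (hν.mono fun t ht => ?_)
        have hm1 : Measurable fun x => g x t ^ Q * ballAverage h x t :=
          ((hgt t).pow_const Q).mul (measurable_ballAverage_left hh t)
        rw [← lintegral_const_mul _ hm1]
        refine lintegral_mono fun x => ?_
        calc c ^ (Q - 1) * (g x t ^ Q * ballAverage h x t)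
            ≤ c ^ (Q - 1) * (g x t ^ Q * (8 ^ d * localMaximal h x)) := by
              gcongr
              exact average_le_localMaximal h x ht.1 ht.2.le
          _ = _ := by ring
    _ = c ^ (Q - 1) * 8 ^ d * ∫⁻ x, (∫⁻ t, g x t ^ Q ∂ν) * localMaximal h x := by
        have hm1 : Measurable fun x => (∫⁻ t, g x t ^ Q ∂ν) * localMaximal h x := hG.mul hhM
        rw [← lintegral_lintegral_swap_of_measurable hF2, ← lintegral_const_mul _ hm1]
        refine lintegral_congr fun x => ?_
        have hgx : Measurable fun t => g x t ^ Q := hgQ.of_uncurry_left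
        rw [lintegral_const_mul _ (hgx.mul_const _), lintegral_mul_const _ hgx]
    _ ≤ c ^ (Q - 1) * 8 ^ d * (I ^ (1 / S) * (CM * ∫⁻ x, h x ^ S') ^ (1 / S')) := by
        gcongr c ^ (Q - 1) * 8 ^ d * ?_
        refine (ENNReal.lintegral_mul_le_Lp_mul_Lq _ hS hG.aemeasurable hhM.aemeasurable).trans ?_
        have := hS.symm.one_div_nonneg
        gcongr
        exact hM h hh
    _ = _ := by
        rw [ENNReal.mul_rpow_of_nonneg _ _ hS.symm.one_div_nonneg]; ring

theorem vectorValued_ballAverage_le_of_gt (d : ℕ) {P Q : ℝ} (hP : 1 < P) (hPQ : P < Q) :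
    ∃ C : ℝ≥0∞, C ≠ ⊤ ∧ ∀ (ν : Measure ℝ) [SFinite ν], (∀ᵐ t ∂ν, t ∈ Ioo (0 : ℝ) 1) →
      ∀ g : EuclideanSpace ℝ (Fin d) → ℝ → ℝ≥0∞, Measurable (Function.uncurry g) →
        ∫⁻ x, (∫⁻ t, ballAverage (fun y => g y t) x t ^ Q ∂ν) ^ (P / Q) ≤
          C * ∫⁻ x, (∫⁻ t, g x t ^ Q ∂ν) ^ (P / Q) := by
  set c := 2 ^ d * volume (Metric.ball (0 : EuclideanSpace ℝ (Fin d)) 1) with hc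
  have hct : c ≠ ⊤ := ENNReal.mul_ne_top (ENNReal.pow_ne_top (by norm_num)) volume_unit_ball_ne_top
  have hQ1 : 1 < Q := hP.trans hPQ
  have hQ0 : 0 < Q := by linarith
  have hP0 : 0 < P := by linarith
  have hQ : Q.HolderConjugate Q.conjExponent := Real.HolderConjugate.conjExponent hQ1
  set Q' := Q.conjExponent with hQ'
  set b := (Q - P) / (Q - 1) with hb
  have hb0 : 0 < b := div_pos (by linarith) (by linarith)
  have hs : 1 < P / b := by
    rw [one_lt_div hb0, hb, div_lt_iff₀ (by linarith)]; nlinarith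
  set s := P / b with hs'
  obtain ⟨CM, hCM, hM⟩ := lintegral_localMaximal_rpow_le d hs
  have hR : (Q / P).HolderConjugate (Q / P).conjExponent :=
    Real.HolderConjugate.conjExponent (by rwa [one_lt_div hP0])
  set R := Q / P with hR'
  set R' := R.conjExponent with hR''
  have hRinv : 1 / R = P / Q := by rw [hR']; field_simp
  set m := 1 - P / Q with hm
  have hRinv' : 1 / R' = m := by
    have := hR.inv_add_inv_eq_one
    rw [one_div] at *; rw [hm]; linarith
  have hm0 : 0 < m := by rw [← hRinv']; exact hR.symm.one_div_pos
  refine ⟨c ^ (P / Q) * ((8 ^ d) ^ s * CM) ^ m + 1, ?_, ?_⟩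
  · refine ENNReal.add_ne_top.2 ⟨ENNReal.mul_ne_top (ENNReal.rpow_ne_top_of_nonneg (by positivity) hct)
      (ENNReal.rpow_ne_top_of_nonneg hm0.le (ENNReal.mul_ne_top
        (ENNReal.rpow_ne_top_of_nonneg (by linarith) (ENNReal.pow_ne_top (by norm_num))) hCM)), ENNReal.one_ne_top⟩
  intro ν _ hν g hg
  have hgt : ∀ t, Measurable fun y => g y t := fun t => hg.comp measurable_prodMk_right
  have hgQ : Measurable (Function.uncurry fun x t => g x t ^ Q) := hg.pow_const Q
  set w : EuclideanSpace ℝ (Fin d) → ℝ≥0∞ := fun x => ∫⁻ t, g x t ^ Q ∂ν with hw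
  have hwm : Measurable w := hgQ.lintegral_prod_right
  set I := ∫⁻ x, w x ^ (P / Q) with hI
  by_cases hIt : I = ⊤
  · rw [hIt, ENNReal.mul_top (by simp)]
    exact le_top
  set e := m / Q with he
  have he0 : 0 < e := div_pos hm0 hQ0
  have hae : ∀ᵐ t ∂ν, ∀ᵐ y, g y t ≤ g y t * w y ^ (-e) * w y ^ e := by
    have hset : MeasurableSet {z : EuclideanSpace ℝ (Fin d) × ℝ |
        g z.1 z.2 ≤ g z.1 z.2 * w z.1 ^ (-e) * w z.1 ^ e} := by
      have hw1 : Measurable fun z : EuclideanSpace ℝ (Fin d) × ℝ => w z.1 :=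
        hwm.comp measurable_fst
      have hg1 : Measurable fun z : EuclideanSpace ℝ (Fin d) × ℝ => g z.1 z.2 := hg
      exact measurableSet_le hg1 ((hg1.mul (hw1.pow_const _)).mul (hw1.pow_const _))
    rw [← Measure.ae_ae_comm (p := fun y t => g y t ≤ g y t * w y ^ (-e) * w y ^ e) hset]
    filter_upwards [ae_lt_top (hwm.pow_const (P / Q)) hIt] with y hy
    by_cases hy0 : w y = 0
    · have hgy : Measurable fun t => g y t ^ Q := hgQ.of_uncurry_left
      filter_upwards [(lintegral_eq_zero_iff hgy).1 hy0] with t ht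
      have : g y t = 0 := by simpa [hQ0, hQ0.le, hQ0.not_gt] using ht
      simp [this]
    · have hyt : w y ≠ ⊤ := by
        intro h
        rw [h, ENNReal.top_rpow_of_pos (by positivity)] at hy
        exact lt_irrefl _ hy
      refine ae_of_all _ fun t => ?_
      rw [mul_assoc, ← ENNReal.rpow_add _ _ hy0 hyt, neg_add_cancel, ENNReal.rpow_zero, mul_one]
  set M := localMaximal (fun y => w y ^ (e * Q')) with hMdef
  have hweQ : Measurable fun y => w y ^ (e * Q') := hwm.pow_const _
  have hMm : Measurable M := measurable_localMaximal hweQ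
  set k : EuclideanSpace ℝ (Fin d) → ℝ → ℝ≥0∞ := fun y t => g y t * w y ^ (-e) with hk
  have hkm : Measurable (Function.uncurry k) :=
    hg.mul ((hwm.pow_const _).comp measurable_fst)
  have hkQ : Measurable (Function.uncurry fun y t => k y t ^ Q) := hkm.pow_const Q
  have hkt : ∀ t, Measurable fun y => k y t := fun t => hkm.comp measurable_prodMk_right
  set Φ : EuclideanSpace ℝ (Fin d) → ℝ≥0∞ :=
    fun x => ∫⁻ t, ballAverage (fun y => k y t ^ Q) x t ∂ν with hΦ
  have hBk : Measurable (Function.uncurry fun x t => ballAverage (fun y => k y t ^ Q) x t) :=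
    measurable_ballAverage hkQ
  have hckQ : Measurable (Function.uncurry fun y t => c * k y t ^ Q) := hkQ.const_mul c
  have hΦm : Measurable Φ := hBk.lintegral_prod_right
  have hpt : ∀ x, ∫⁻ t, ballAverage (fun y => g y t) x t ^ Q ∂ν ≤
      Φ x * (8 ^ d * M x) ^ (Q / Q') := by
    intro x
    have hBkx : Measurable fun t => ballAverage (fun y => k y t ^ Q) x t :=
      hBk.of_uncurry_left
    simp only [hΦ]
    rw [← lintegral_mul_const _ hBkx]
    refine lintegral_mono_ae ?_
    filter_upwards [hν, hae] with t ht hty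
    have h1 := (ballAverage_mono_ae hty x t).trans
      (ballAverage_mul_le hQ (hkt t) (hwm.pow_const e) x t)
    refine (ENNReal.rpow_le_rpow h1 hQ0.le).trans ?_
    rw [ENNReal.mul_rpow_of_nonneg _ _ hQ0.le, ← ENNReal.rpow_mul, ← ENNReal.rpow_mul,
      one_div_mul_cancel hQ0.ne', ENNReal.rpow_one, one_div_mul_eq_div]
    have : 0 ≤ Q / Q' := div_nonneg hQ0.le hQ.symm.nonneg
    gcongr
    simp only [← ENNReal.rpow_mul]
    exact average_le_localMaximal _ x ht.1 ht.2.le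
  have hΦint : ∫⁻ x, Φ x ≤ c * I := by
    simp only [hΦ]
    rw [lintegral_lintegral_swap_of_measurable hBk]
    have h1 : ∫⁻ t, (∫⁻ x, ballAverage (fun y => k y t ^ Q) x t) ∂ν =
        ∫⁻ t, (∫⁻ x, c * k x t ^ Q) ∂ν := by
      refine lintegral_congr_ae (hν.mono fun t ht => ?_)
      simp only
      rw [lintegral_ballAverage ((hkt t).pow_const Q) ht.1,
        lintegral_const_mul _ ((hkt t).pow_const Q)]
    rw [h1, ← lintegral_lintegral_swap_of_measurable hckQ, hI,
      ← lintegral_const_mul _ (hwm.pow_const _)]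
    refine lintegral_mono fun x => ?_
    have hkx : Measurable fun t => k x t ^ Q := hkQ.of_uncurry_left
    have hgx : Measurable fun t => g x t ^ Q := hgQ.of_uncurry_left
    rw [lintegral_const_mul _ hkx]
    gcongr c * ?_
    simp only [hk, ENNReal.mul_rpow_of_nonneg _ _ hQ0.le]
    rw [lintegral_mul_const _ hgx, ← ENNReal.rpow_mul, he, neg_mul, div_mul_cancel₀ _ hQ0.ne']
    change w x * w x ^ (-m) ≤ _
    by_cases hx0 : w x = 0
    · simp [hx0]
    by_cases hxt : w x = ⊤
    · simp [hxt, hm0]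
    nth_rw 1 [← ENNReal.rpow_one (w x)]
    rw [← ENNReal.rpow_add _ _ hx0 hxt, hm]
    apply le_of_eq
    congr 1; ring
  calc ∫⁻ x, (∫⁻ t, ballAverage (fun y => g y t) x t ^ Q ∂ν) ^ (P / Q)
      ≤ ∫⁻ x, Φ x ^ (P / Q) * (8 ^ d * M x) ^ (Q / Q' * (P / Q)) := by
        refine lintegral_mono fun x => ?_
        rw [ENNReal.rpow_mul, ← ENNReal.mul_rpow_of_nonneg _ _ (by positivity)]
        exact ENNReal.rpow_le_rpow (hpt x) (by positivity)
    _ ≤ (∫⁻ x, (Φ x ^ (P / Q)) ^ R) ^ (1 / R) *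
          (∫⁻ x, ((8 ^ d * M x) ^ (Q / Q' * (P / Q))) ^ R') ^ (1 / R') :=
        ENNReal.lintegral_mul_le_Lp_mul_Lq _ hR (hΦm.pow_const _).aemeasurable
          ((hMm.const_mul _).pow_const _).aemeasurable
    _ = (∫⁻ x, Φ x) ^ (P / Q) * (∫⁻ x, (8 ^ d * M x) ^ s) ^ m := by
        simp only [← ENNReal.rpow_mul]
        rw [hRinv, hRinv']
        have h1 : P / Q * R = 1 := by rw [hR']; field_simp
        have h2 : Q / Q' * (P / Q) * R' = s := by
          have h3 : R' = 1 / m := by rw [← hRinv', one_div_one_div]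
          have hQ1' : Q - 1 ≠ 0 := by linarith
          have hQP : Q - P ≠ 0 := by linarith
          rw [h3, hm, hs', hb, hQ', Real.conjExponent]
          field_simp
        simp only [h1, h2, ENNReal.rpow_one]
    _ ≤ (c * I) ^ (P / Q) * ((8 ^ d) ^ s * (CM * I)) ^ m := by
        have hPQ0 : 0 ≤ P / Q := by positivity
        have h8 : ∫⁻ x, (8 ^ d * M x) ^ s ≤ (8 ^ d) ^ s * (CM * I) := by
          simp only [ENNReal.mul_rpow_of_nonneg _ _ (show 0 ≤ s by linarith)]
          rw [lintegral_const_mul _ (hMm.pow_const _)]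
          gcongr
          refine (hM _ hweQ).trans_eq ?_
          congr 2 with x
          rw [← ENNReal.rpow_mul]
          congr 1
          have hQ1' : Q - 1 ≠ 0 := by linarith
          have hQP : Q - P ≠ 0 := by linarith
          rw [he, hm, hs', hb, hQ', Real.conjExponent]
          field_simp
        gcongr
    _ = c ^ (P / Q) * ((8 ^ d) ^ s * CM) ^ m * (I ^ (P / Q) * I ^ m) := by
        rw [← mul_assoc ((8 ^ d) ^ s), ENNReal.mul_rpow_of_nonneg _ _ (by positivity),
          ENNReal.mul_rpow_of_nonneg _ _ hm0.le]
        ring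
    _ = c ^ (P / Q) * ((8 ^ d) ^ s * CM) ^ m * I := by
        rw [← ENNReal.rpow_add_of_nonneg _ _ (by positivity) hm0.le, hm, add_sub_cancel,
          ENNReal.rpow_one]
    _ ≤ _ := by
        gcongr
        exact le_self_add

end VectorValued

section MixedNorm

variable {d : ℕ}

theorem measurable_eLpNorm_right {α β : Type*} [MeasurableSpace α] [MeasurableSpace β]
    {ν : Measure β} [SFinite ν] (q : ℝ≥0∞) {F : α → β → ℝ≥0∞}
    (hF : Measurable (Function.uncurry F)) : Measurable fun x => eLpNorm (F x) q ν := by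
  by_cases hq0 : q = 0
  · simp only [hq0, eLpNorm_exponent_zero]; exact measurable_const
  by_cases hqt : q = ⊤
  · simp only [hqt, eLpNorm_exponent_top, eLpNormEssSup, enorm_eq_self]
    refine measurable_of_Ioi fun a => ?_
    have hset : MeasurableSet {z : α × β | a < F z.1 z.2} :=
      measurableSet_lt measurable_const hF
    have h1 : (fun x => essSup (fun t => F x t) ν) ⁻¹' Ioi a =
        {x | ν (Prod.mk x ⁻¹' {z : α × β | a < F z.1 z.2}) ≠ 0} := by
      ext x
      simp only [mem_preimage, mem_Ioi, mem_ofPred_eq]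
      rw [← not_le, not_iff_not]
      constructor
      · intro h
        refine measure_mono_null ?_ (ENNReal.ae_le_essSup (μ := ν) (F x))
        intro t ht
        simp only [mem_preimage, mem_ofPred_eq] at ht
        exact not_le.2 (h.trans_lt ht)
      · intro h
        refine essSup_le_of_ae_le a ?_
        filter_upwards [measure_eq_zero_iff_ae_notMem.1 h] with t ht
        exact not_lt.1 ht
    rw [h1]
    exact (measurable_measure_prodMk_left hset) (measurableSet_singleton 0).compl
  · simp only [eLpNorm_eq_lintegral_rpow_enorm_toReal hq0 hqt, enorm_eq_self]
    have hFq : Measurable (Function.uncurry fun x t => F x t ^ q.toReal) := hF.pow_const _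
    exact hFq.lintegral_prod_right.pow_const _

theorem eLpNorm_tsum_le {α : Type*} [MeasurableSpace α] {μ : Measure α} {p : ℝ≥0∞}
    (hp : 1 ≤ p) {F : ℕ → α → ℝ≥0∞} (hF : ∀ k, Measurable (F k)) :
    eLpNorm (fun x => ∑' k, F k x) p μ ≤ ∑' k, eLpNorm (F k) p μ := by
  by_cases hpt : p = ⊤
  · subst hpt
    simp only [eLpNorm_exponent_top, eLpNormEssSup, enorm_eq_self]
    refine essSup_le_of_ae_le _ ?_
    filter_upwards [ae_all_iff.2 fun k => ENNReal.ae_le_essSup (μ := μ) (F k)] with x hx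
    exact ENNReal.tsum_le_tsum hx
  have hp0 : p ≠ 0 := (zero_lt_one.trans_le hp).ne'
  have hp' : 0 < p.toReal := ENNReal.toReal_pos hp0 hpt
  have hfin : ∀ n, eLpNorm (fun x => ∑ k ∈ Finset.range n, F k x) p μ ≤
      ∑' k, eLpNorm (F k) p μ := by
    intro n
    refine le_trans ?_ (ENNReal.sum_le_tsum (Finset.range n))
    have hsum : (fun x => ∑ k ∈ Finset.range n, F k x) = ∑ k ∈ Finset.range n, F k := by
      ext x; simp
    rw [hsum]
    exact eLpNorm_sum_le (fun k _ => (hF k).aestronglyMeasurable) hp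
  have hmeas : ∀ n, Measurable fun x => ∑ k ∈ Finset.range n, F k x := fun n =>
    Finset.measurable_sum _ fun k _ => hF k
  simp only [eLpNorm_eq_lintegral_rpow_enorm_toReal hp0 hpt, enorm_eq_self] at hfin ⊢
  set K := ∑' k, (∫⁻ x, F k x ^ p.toReal ∂μ) ^ (1 / p.toReal)
  have hfin' : ∀ n, ∫⁻ x, (∑ k ∈ Finset.range n, F k x) ^ p.toReal ∂μ ≤ K ^ p.toReal := by
    intro n
    rw [← ENNReal.rpow_inv_le_iff hp', ← one_div]
    exact hfin n
  rw [one_div, ENNReal.rpow_inv_le_iff hp']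
  calc ∫⁻ x, (∑' k, F k x) ^ p.toReal ∂μ
      = ∫⁻ x, ⨆ n, (∑ k ∈ Finset.range n, F k x) ^ p.toReal ∂μ := by
        refine lintegral_congr fun x => ?_
        have := (ENNReal.orderIsoRpow p.toReal hp').map_iSup
          (fun n => ∑ k ∈ Finset.range n, F k x)
        simp only [ENNReal.orderIsoRpow_apply] at this
        rw [ENNReal.tsum_eq_iSup_nat, this]
    _ = ⨆ n, ∫⁻ x, (∑ k ∈ Finset.range n, F k x) ^ p.toReal ∂μ := by
        refine lintegral_iSup (fun n => (hmeas n).pow_const _) fun m n hmn x => ?_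
        refine ENNReal.rpow_le_rpow ?_ hp'.le
        exact Finset.sum_le_sum_of_subset (Finset.range_mono hmn)
    _ ≤ K ^ p.toReal := iSup_le hfin'

/-- The norm of `L^p(ℝ^d; L^q(ν))`. -/
def mixedNorm (p q : ℝ≥0∞) (ν : Measure ℝ) (F : EuclideanSpace ℝ (Fin d) → ℝ → ℝ≥0∞) : ℝ≥0∞ :=
  eLpNorm (fun x => eLpNorm (F x) q ν) p volume

variable {p q : ℝ≥0∞} {ν : Measure ℝ} {F G : EuclideanSpace ℝ (Fin d) → ℝ → ℝ≥0∞}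

theorem mixedNorm_mono (h : ∀ᵐ x, ∀ᵐ t ∂ν, F x t ≤ G x t) :
    mixedNorm p q ν F ≤ mixedNorm p q ν G := by
  refine eLpNorm_mono_enorm_ae ?_
  filter_upwards [h] with x hx
  simp only [enorm_eq_self]
  refine eLpNorm_mono_enorm_ae ?_
  filter_upwards [hx] with t ht
  simpa using ht

theorem eLpNorm_const_mul_le {α : Type*} [MeasurableSpace α] {μ : Measure α} (c : ℝ≥0∞)
    {f : α → ℝ≥0∞} (hf : Measurable f) :
    eLpNorm (fun x => c * f x) p μ ≤ c * eLpNorm f p μ :=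
  eLpNorm_le_mul_eLpNorm_of_ae_le_mul'' p hf.aestronglyMeasurable (ae_of_all _ fun x => by simp)

theorem mixedNorm_const_mul_le [SFinite ν] (c : ℝ≥0∞) (hF : Measurable (Function.uncurry F)) :
    mixedNorm p q ν (fun x t => c * F x t) ≤ c * mixedNorm p q ν F := by
  refine le_trans ?_ (eLpNorm_const_mul_le c (measurable_eLpNorm_right q hF))
  refine eLpNorm_mono_enorm fun x => ?_
  simp only [enorm_eq_self]
  exact eLpNorm_const_mul_le c hF.of_uncurry_left

theorem mixedNorm_add_le [SFinite ν] (hp : 1 ≤ p) (hq : 1 ≤ q)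
    (hF : Measurable (Function.uncurry F)) (hG : Measurable (Function.uncurry G)) :
    mixedNorm p q ν (fun x t => F x t + G x t) ≤ mixedNorm p q ν F + mixedNorm p q ν G := by
  refine le_trans ?_ (eLpNorm_add_le (measurable_eLpNorm_right q hF).aestronglyMeasurable
    (measurable_eLpNorm_right q hG).aestronglyMeasurable hp)
  refine eLpNorm_mono_enorm fun x => ?_
  simp only [enorm_eq_self, Pi.add_apply]
  exact eLpNorm_add_le hF.of_uncurry_left.aestronglyMeasurable
    hG.of_uncurry_left.aestronglyMeasurable hq

theorem mixedNorm_tsum_le [SFinite ν] (hp : 1 ≤ p) (hq : 1 ≤ q)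
    {F : ℕ → EuclideanSpace ℝ (Fin d) → ℝ → ℝ≥0∞} (hF : ∀ k, Measurable (Function.uncurry (F k))) :
    mixedNorm p q ν (fun x t => ∑' k, F k x t) ≤ ∑' k, mixedNorm p q ν (F k) := by
  refine le_trans ?_ (eLpNorm_tsum_le hp fun k => measurable_eLpNorm_right q (hF k))
  refine eLpNorm_mono_enorm fun x => ?_
  simp only [enorm_eq_self]
  exact eLpNorm_tsum_le hq fun k => (hF k).of_uncurry_left

theorem mixedNorm_eq {p : ℝ} (hp : 0 < p) :
    mixedNorm (ENNReal.ofReal p) q ν F = (∫⁻ x, eLpNorm (F x) q ν ^ p) ^ (1 / p) := by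
  rw [mixedNorm, eLpNorm_eq_lintegral_rpow_enorm_toReal (by simpa using hp) ofReal_ne_top,
    ENNReal.toReal_ofReal hp.le]
  simp only [enorm_eq_self]

/-- The Fefferman–Stein inequality for averages of `r`-th powers, `r < min p q`. -/
theorem mixedNorm_ballAverage_le (d : ℕ) {p : ℝ} {q : ℝ≥0∞} {r : ℝ} (hr : 0 < r) (hrp : r < p)
    (hrq : ENNReal.ofReal r < q) :
    ∃ C : ℝ≥0∞, C ≠ ⊤ ∧ ∀ (ν : Measure ℝ) [SFinite ν], (∀ᵐ t ∂ν, t ∈ Ioo (0 : ℝ) 1) →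
      ∀ g : EuclideanSpace ℝ (Fin d) → ℝ → ℝ≥0∞, Measurable (Function.uncurry g) →
        mixedNorm (ENNReal.ofReal p) q ν
            (fun x t => ballAverage (fun y => g y t ^ r) x t ^ (1 / r)) ≤
          C * mixedNorm (ENNReal.ofReal p) q ν g := by
  have hp : 0 < p := hr.trans hrp
  have hrp' : 1 < p / r := (one_lt_div hr).2 hrp
  suffices H : ∃ C : ℝ≥0∞, C ≠ ⊤ ∧ ∀ (ν : Measure ℝ) [SFinite ν], (∀ᵐ t ∂ν, t ∈ Ioo (0 : ℝ) 1) →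
      ∀ g : EuclideanSpace ℝ (Fin d) → ℝ → ℝ≥0∞, Measurable (Function.uncurry g) →
        ∫⁻ x, eLpNorm (fun t => ballAverage (fun y => g y t ^ r) x t ^ (1 / r)) q ν ^ p ≤
          C * ∫⁻ x, eLpNorm (g x) q ν ^ p by
    obtain ⟨C, hC, H⟩ := H
    refine ⟨C ^ (1 / p), ENNReal.rpow_ne_top_of_nonneg (by positivity) hC, ?_⟩
    intro ν _ hν g hg
    rw [mixedNorm_eq hp, mixedNorm_eq hp, ← ENNReal.mul_rpow_of_nonneg _ _ (by positivity)]
    exact ENNReal.rpow_le_rpow (H ν hν g hg) (by positivity)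
  by_cases hqt : q = ⊤
  · obtain ⟨CM, hCM, hM⟩ := lintegral_localMaximal_rpow_le d hrp'
    refine ⟨(8 ^ d) ^ (p / r) * CM, ENNReal.mul_ne_top (ENNReal.rpow_ne_top_of_nonneg
      (by positivity) (ENNReal.pow_ne_top (by norm_num))) hCM, ?_⟩
    intro ν _ hν g hg
    set w : EuclideanSpace ℝ (Fin d) → ℝ≥0∞ := fun x => eLpNorm (g x) q ν
    have hw : Measurable w := measurable_eLpNorm_right q hg
    have hwr : Measurable fun x => w x ^ r := hw.pow_const r
    have hae : ∀ᵐ t ∂ν, ∀ᵐ y, g y t ≤ w y := by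
      have hset : MeasurableSet {z : EuclideanSpace ℝ (Fin d) × ℝ | g z.1 z.2 ≤ w z.1} :=
        measurableSet_le hg (hw.comp measurable_fst)
      rw [← Measure.ae_ae_comm (p := fun y t => g y t ≤ w y) hset]
      refine ae_of_all _ fun y => ?_
      simp only [w, hqt, eLpNorm_exponent_top, eLpNormEssSup, enorm_eq_self]
      exact ENNReal.ae_le_essSup (g y)
    calc ∫⁻ x, eLpNorm (fun t => ballAverage (fun y => g y t ^ r) x t ^ (1 / r)) q ν ^ p
        ≤ ∫⁻ x, (8 ^ d * localMaximal (fun y => w y ^ r) x) ^ (p / r) := by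
          refine lintegral_mono fun x => ?_
          rw [show p / r = 1 / r * p by ring, ENNReal.rpow_mul]
          refine ENNReal.rpow_le_rpow ?_ hp.le
          simp only [hqt, eLpNorm_exponent_top, eLpNormEssSup, enorm_eq_self]
          refine essSup_le_of_ae_le _ ?_
          filter_upwards [hν, hae] with t ht hty
          refine ENNReal.rpow_le_rpow ?_ (by positivity)
          refine (ballAverage_mono_ae (h := fun y => w y ^ r) ?_ x t).trans
            (average_le_localMaximal _ x ht.1 ht.2.le)
          filter_upwards [hty] with y hy
          exact ENNReal.rpow_le_rpow hy hr.le
      _ ≤ (8 ^ d) ^ (p / r) * (CM * ∫⁻ x, (w x ^ r) ^ (p / r)) := by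
          simp only [ENNReal.mul_rpow_of_nonneg _ _ (show 0 ≤ p / r by positivity)]
          rw [lintegral_const_mul _ ((measurable_localMaximal hwr).pow_const _)]
          gcongr
          exact hM _ hwr
      _ = (8 ^ d) ^ (p / r) * CM * ∫⁻ x, w x ^ p := by
          rw [mul_assoc]
          simp only [← ENNReal.rpow_mul, mul_div_cancel₀ p hr.ne']
  have hq0 : q ≠ 0 := (bot_le.trans_lt hrq).ne'
  have hq' : 0 < q.toReal := ENNReal.toReal_pos hq0 hqt
  have hrq' : 1 < q.toReal / r := by
    rw [one_lt_div hr]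
    exact (ENNReal.ofReal_lt_iff_lt_toReal hr.le hqt).1 hrq
  have hPQ : p / q.toReal = p / r / (q.toReal / r) := by field_simp
  obtain ⟨C, hC, hV⟩ : ∃ C : ℝ≥0∞, C ≠ ⊤ ∧ ∀ (ν : Measure ℝ) [SFinite ν],
      (∀ᵐ t ∂ν, t ∈ Ioo (0 : ℝ) 1) →
      ∀ g : EuclideanSpace ℝ (Fin d) → ℝ → ℝ≥0∞, Measurable (Function.uncurry g) →
        ∫⁻ x, (∫⁻ t, ballAverage (fun y => g y t) x t ^ (q.toReal / r) ∂ν) ^ (p / q.toReal) ≤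
          C * ∫⁻ x, (∫⁻ t, g x t ^ (q.toReal / r) ∂ν) ^ (p / q.toReal) := by
    rw [hPQ]
    rcases lt_trichotomy (q.toReal / r) (p / r) with h | h | h
    · exact vectorValued_ballAverage_le_of_lt d hrq' h
    · rw [h, div_self (by positivity)]
      simp only [ENNReal.rpow_one]
      exact vectorValued_ballAverage_le_of_eq d hrp'
    · exact vectorValued_ballAverage_le_of_gt d hrp' h
  refine ⟨C, hC, fun ν _ hν g hg => ?_⟩
  have hgr : Measurable (Function.uncurry fun x t => g x t ^ r) := hg.pow_const r
  have h1 := hV ν hν (fun x t => g x t ^ r) hgr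
  simp only [← ENNReal.rpow_mul, mul_div_cancel₀ q.toReal hr.ne'] at h1
  simp only [eLpNorm_eq_lintegral_rpow_enorm_toReal hq0 hqt, enorm_eq_self, ← ENNReal.rpow_mul,
    one_div_mul_eq_div]
  exact h1

end MixedNorm

section LogMeasure

/-- The measure `dt / t` on `(0, ∞)`. -/
def invMeasure : Measure ℝ :=
  (volume.restrict (Ioi 0)).withDensity fun t => ENNReal.ofReal t⁻¹

instance : SFinite invMeasure := by unfold invMeasure; infer_instance

theorem map_mul_left_invMeasure {c : ℝ} (hc : 0 < c) :
    invMeasure.map (fun t => c * t) = invMeasure := by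
  have hcm : Measurable fun t : ℝ => c * t := measurable_const_mul c
  have hden : Measurable fun t : ℝ => ENNReal.ofReal t⁻¹ := by fun_prop
  have key : ∀ s : Set ℝ, MeasurableSet s → invMeasure s =
      ∫⁻ t, (s ∩ Ioi 0).indicator (fun t => ENNReal.ofReal t⁻¹) t := by
    intro s hs
    rw [invMeasure, withDensity_apply _ hs, Measure.restrict_restrict hs,
      lintegral_indicator (hs.inter measurableSet_Ioi)]
  ext s hs
  have hG : Measurable ((s ∩ Ioi 0).indicator fun t : ℝ => ENNReal.ofReal t⁻¹) :=
    hden.indicator (hs.inter measurableSet_Ioi)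
  rw [Measure.map_apply hcm hs, key _ (hcm hs), key _ hs]
  have h1 : ∀ t, ((fun t => c * t) ⁻¹' s ∩ Ioi 0).indicator (fun t => ENNReal.ofReal t⁻¹) t =
      ENNReal.ofReal c * (s ∩ Ioi 0).indicator (fun t => ENNReal.ofReal t⁻¹) (c * t) := by
    intro t
    by_cases ht : c * t ∈ s ∩ Ioi 0
    · have ht' : t ∈ (fun t => c * t) ⁻¹' s ∩ Ioi 0 :=
        ⟨ht.1, pos_of_mul_pos_right ht.2 hc.le⟩
      rw [indicator_of_mem ht, indicator_of_mem ht', ← ENNReal.ofReal_mul hc.le]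
      congr 1
      field_simp
    · have ht' : t ∉ (fun t => c * t) ⁻¹' s ∩ Ioi 0 := fun h =>
        ht ⟨h.1, mul_pos hc h.2⟩
      rw [indicator_of_notMem ht, indicator_of_notMem ht', mul_zero]
  simp only [h1]
  have hGc : Measurable fun t =>
      (s ∩ Ioi 0).indicator (fun t : ℝ => ENNReal.ofReal t⁻¹) (c * t) := hG.comp hcm
  rw [lintegral_const_mul _ hGc, ← lintegral_map hG hcm,
    Real.map_volume_mul_left hc.ne', lintegral_smul_measure, smul_eq_mul, ← mul_assoc,
    ← ENNReal.ofReal_mul hc.le, abs_of_pos (inv_pos.2 hc), mul_inv_cancel₀ hc.ne',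
    ENNReal.ofReal_one, one_mul]

/-- The measure `dt / t` on `(0, 1)`. -/
def unitInvMeasure : Measure ℝ := invMeasure.restrict (Ioo 0 1)

instance : SFinite unitInvMeasure := by unfold unitInvMeasure; infer_instance

theorem ae_unitInvMeasure_mem : ∀ᵐ t ∂unitInvMeasure, t ∈ Ioo (0 : ℝ) 1 :=
  ae_restrict_mem measurableSet_Ioo

theorem unitInvMeasure_eq : unitInvMeasure =
    (volume.restrict (Ioo 0 1)).withDensity fun t => ENNReal.ofReal t⁻¹ := by
  rw [unitInvMeasure, invMeasure, restrict_withDensity measurableSet_Ioo,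
    Measure.restrict_restrict measurableSet_Ioo,
    inter_eq_left.2 (Ioo_subset_Ioi_self : Ioo (0 : ℝ) 1 ⊆ Ioi 0)]

theorem lintegral_unitInvMeasure {h : ℝ → ℝ≥0∞} :
    ∫⁻ t, h t ∂unitInvMeasure = ∫⁻ t in Ioo (0 : ℝ) 1, h t * ENNReal.ofReal t⁻¹ := by
  rw [unitInvMeasure_eq, lintegral_withDensity_eq_lintegral_mul_non_measurable _ (by fun_prop)
    (ae_of_all _ fun t => ofReal_lt_top)]
  refine lintegral_congr fun t => ?_
  rw [Pi.mul_apply, mul_comm]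

theorem essSup_unitInvMeasure {h : ℝ → ℝ≥0∞} :
    essSup h unitInvMeasure = essSup h (volume.restrict (Ioo (0 : ℝ) 1)) := by
  rw [unitInvMeasure_eq]
  have h1 : ((volume.restrict (Ioo (0 : ℝ) 1)).withDensity fun t => ENNReal.ofReal t⁻¹) ≪
    volume.restrict (Ioo (0 : ℝ) 1) := withDensity_absolutelyContinuous _ _
  have h2 : volume.restrict (Ioo (0 : ℝ) 1) ≪
      (volume.restrict (Ioo (0 : ℝ) 1)).withDensity fun t => ENNReal.ofReal t⁻¹ := by
    refine withDensity_absolutelyContinuous' (by fun_prop) ?_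
    filter_upwards [ae_restrict_mem measurableSet_Ioo] with t ht
    simpa using ht.1
  exact le_antisymm (essSup_mono_measure h1) (essSup_mono_measure h2)

theorem eLpNorm_comp_mul_left_le {q : ℝ≥0∞} {c : ℝ} (hc : 0 < c) {h : ℝ → ℝ≥0∞}
    (hh : Measurable h) (h0 : ∀ t, t ∉ Ioo (0 : ℝ) 1 → h t = 0) :
    eLpNorm (fun t => h (c * t)) q unitInvMeasure ≤ eLpNorm h q unitInvMeasure := by
  have hcm : Measurable fun t : ℝ => c * t := measurable_const_mul c
  have hind : (Ioo (0 : ℝ) 1).indicator h = h := indicator_eq_self.2 fun t ht => by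
    by_contra h'; exact ht (h0 t h')
  calc eLpNorm (fun t => h (c * t)) q unitInvMeasure
      ≤ eLpNorm (fun t => h (c * t)) q invMeasure :=
        eLpNorm_mono_measure _ Measure.restrict_le_self
    _ = eLpNorm h q (invMeasure.map fun t => c * t) :=
        (eLpNorm_map_measure hh.aestronglyMeasurable hcm.aemeasurable).symm
    _ = eLpNorm h q unitInvMeasure := by
        rw [map_mul_left_invMeasure hc, unitInvMeasure,
          ← eLpNorm_indicator_eq_eLpNorm_restrict measurableSet_Ioo, hind]

variable {d : ℕ}

theorem mixedNorm_comp_mul_left_le {p q : ℝ≥0∞} {c : ℝ} (hc : 0 < c)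
    {F : EuclideanSpace ℝ (Fin d) → ℝ → ℝ≥0∞} (hF : Measurable (Function.uncurry F))
    (h0 : ∀ x t, t ∉ Ioo (0 : ℝ) 1 → F x t = 0) :
    mixedNorm p q unitInvMeasure (fun x t => F x (c * t)) ≤ mixedNorm p q unitInvMeasure F := by
  refine eLpNorm_mono_enorm fun x => ?_
  simp only [enorm_eq_self]
  exact eLpNorm_comp_mul_left_le hc hF.of_uncurry_left (h0 x)

theorem triebelInner_eq {U : Set (EuclideanSpace ℝ (Fin d))} {f : EuclideanSpace ℝ (Fin d) → ℝ}
    {σ : ℝ} {u : ℝ≥0∞} (hu : 1 ≤ u) (x : EuclideanSpace ℝ (Fin d)) (t : ℝ) :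
    triebelInner d U f σ u x t = ENNReal.ofReal (t ^ (-(σ + (d : ℝ) / u.toReal))) *
      eLpNorm (fun y => edist (f x) (f y)) u (volume.restrict (Metric.ball x t ∩ U)) := by
  have hed : ∀ y, ENNReal.ofReal |f x - f y| = edist (f x) (f y) := fun y => by
    rw [edist_dist, Real.dist_eq]
  have hu0 : u ≠ 0 := (zero_lt_one.trans_le hu).ne'
  unfold triebelInner
  congr 1
  split_ifs with h
  · simp only [h, eLpNorm_exponent_top, eLpNormEssSup, enorm_eq_self, hed]
  · simp only [eLpNorm_eq_lintegral_rpow_enorm_toReal hu0 h, enorm_eq_self, hed]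

theorem triebelSeminorm_eq {U : Set (EuclideanSpace ℝ (Fin d))} (hU : MeasurableSet U)
    {f : EuclideanSpace ℝ (Fin d) → ℝ} {σ p : ℝ} (hp : 1 ≤ p) {q u : ℝ≥0∞} (hq : 1 ≤ q) :
    triebelSeminorm d U f σ 1 p q u = mixedNorm (ENNReal.ofReal p) q unitInvMeasure
      (fun x t => U.indicator (fun x => triebelInner d U f σ u x t) x) := by
  have hq0 : q ≠ 0 := (zero_lt_one.trans_le hq).ne'
  have hp0 : 0 < p := by linarith
  rw [triebelSeminorm, mixedNorm_eq hp0, ← lintegral_indicator hU]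
  congr 2 with x
  by_cases hx : x ∈ U
  · simp only [indicator_of_mem hx]
    congr 1
    split_ifs with h
    · simp only [h, eLpNorm_exponent_top, eLpNormEssSup, enorm_eq_self, essSup_unitInvMeasure]
    · simp only [eLpNorm_eq_lintegral_rpow_enorm_toReal hq0 h, enorm_eq_self,
        lintegral_unitInvMeasure]
  · simp [indicator_of_notMem hx, hp0]

theorem lpNormOn_eq {U : Set (EuclideanSpace ℝ (Fin d))} (hU : MeasurableSet U)
    {f : EuclideanSpace ℝ (Fin d) → ℝ} {p : ℝ} :
    lpNormOn d U f p = eLpNorm (U.indicator fun x => ‖f x‖ₑ) (ENNReal.ofReal p) volume := by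
  rw [lpNormOn, ← eLpNorm_indicator_eq_eLpNorm_restrict hU]
  refine eLpNorm_congr_enorm_ae (ae_of_all _ fun x => ?_)
  by_cases hx : x ∈ U <;> simp [hx]

end LogMeasure

section Chain

variable {d : ℕ}

theorem IsCorkscrew.le_volume_ball_inter {ε δ : ℝ} (hε : 0 < ε) (hδ : 0 < δ)
    {Ω : Set (EuclideanSpace ℝ (Fin d))} (hΩ : IsCorkscrew d ε δ Ω)
    {x : EuclideanSpace ℝ (Fin d)} (hx : x ∈ Ω) {t : ℝ} (ht0 : 0 < t) (ht1 : t ≤ 1) :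
    ENNReal.ofReal (min 1 ε * (min 1 δ / 2)) ^ d *
        volume (Metric.ball (0 : EuclideanSpace ℝ (Fin d)) 1) * ENNReal.ofReal t ^ d ≤
      volume (Metric.ball x t ∩ Ω) := by
  obtain ⟨hO, -, -, hc⟩ := hΩ
  set m := min 1 ε with hm
  set n := min 1 δ with hn
  have hm0 : 0 < m := lt_min one_pos hε
  have hn0 : 0 < n := lt_min one_pos hδ
  have hn1 : n ≤ 1 := min_le_left _ _
  suffices H : ∃ y, Metric.ball y (m * (n / 2) * t) ⊆ Metric.ball x t ∩ Ω by
    obtain ⟨y, hy⟩ := H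
    refine le_trans (le_of_eq ?_) (measure_mono hy)
    rw [volume_ball_eq y (by positivity),
      ENNReal.ofReal_mul (p := m * (n / 2)) (by positivity), mul_pow]
    exact mul_right_comm _ _ _
  by_cases hsub : Metric.ball x (n / 2 * t) ⊆ Ω
  · refine ⟨x, subset_inter (Metric.ball_subset_ball ?_)
      ((Metric.ball_subset_ball ?_).trans hsub)⟩
    · calc m * (n / 2) * t ≤ 1 * (1 / 2) * t := by gcongr; exact min_le_left _ _
        _ ≤ t := by linarith
    · calc m * (n / 2) * t ≤ 1 * (n / 2) * t := by gcongr; exact min_le_left _ _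
        _ = _ := by ring
  · have hpre : IsPreconnected (Metric.ball x (n / 2 * t)) :=
      (convex_ball x _).isPreconnected
    obtain ⟨z, hz, hzf⟩ : ∃ z ∈ Metric.ball x (n / 2 * t), z ∈ frontier Ω := by
      by_contra! h
      refine hsub (hpre.subset_left_of_subset_union hO isClosed_closure.isOpen_compl
        (disjoint_compl_right.mono_left subset_closure) ?_
        ⟨x, Metric.mem_ball_self (by positivity), hx⟩)
      intro w hw
      by_cases hwΩ : w ∈ Ω
      · exact Or.inl hwΩ
      · refine Or.inr fun hwc => h w hw ?_
        rw [hO.frontier_eq]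
        exact ⟨hwc, hwΩ⟩
    obtain ⟨y, hy⟩ := hc z hzf (n / 2 * t) (by positivity) (by
      calc n / 2 * t ≤ n * 1 := by gcongr; linarith
        _ ≤ δ := by rw [mul_one]; exact min_le_right _ _)
    refine ⟨y, ?_⟩
    have h1 : Metric.ball y (m * (n / 2) * t) ⊆ Metric.ball y (ε * (n / 2 * t)) := by
      refine Metric.ball_subset_ball ?_
      rw [mul_assoc]
      gcongr
      exact min_le_right _ _
    refine (h1.trans hy).trans (inter_subset_inter_left _ ?_)
    intro w hw
    rw [Metric.mem_ball] at *
    have : n / 2 * t + n / 2 * t ≤ t := by nlinarith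
    linarith [dist_triangle w z x]

/-- The integral of `|f x - f y|` over `y ∈ B(x, t) ∩ U`, normalised by `t ^ d`. -/
def oscAverage (U : Set (EuclideanSpace ℝ (Fin d))) (f : EuclideanSpace ℝ (Fin d) → ℝ)
    (x : EuclideanSpace ℝ (Fin d)) (t : ℝ) : ℝ≥0∞ :=
  (∫⁻ y in Metric.ball x t ∩ U, edist (f x) (f y)) / ENNReal.ofReal t ^ d

variable {U : Set (EuclideanSpace ℝ (Fin d))} {f : EuclideanSpace ℝ (Fin d) → ℝ}

theorem measurable_oscAverage (hU : MeasurableSet U) (hf : Measurable f) :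
    Measurable (Function.uncurry (oscAverage U f)) := by
  have h1 : ∀ z : EuclideanSpace ℝ (Fin d) × ℝ, Function.uncurry (oscAverage U f) z =
      (∫⁻ y in Metric.ball z.1 z.2, U.indicator (fun y => edist (f z.1) (f y)) y) /
        ENNReal.ofReal z.2 ^ d := fun z => by
    rw [setLIntegral_indicator hU, inter_comm]; rfl
  have h2 : Measurable fun z : EuclideanSpace ℝ (Fin d) × ℝ =>
      ∫⁻ y in Metric.ball z.1 z.2, U.indicator (fun y => edist (f z.1) (f y)) y := by
    refine measurable_setLIntegral_ball
      (α := EuclideanSpace ℝ (Fin d) × ℝ)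
      (h := fun z y => U.indicator (fun y => edist (f z.1) (f y)) y) ?_ measurable_fst
      measurable_snd
    have h3 : Measurable fun w : (EuclideanSpace ℝ (Fin d) × ℝ) × EuclideanSpace ℝ (Fin d) =>
        edist (f w.1.1) (f w.2) :=
      (hf.comp (measurable_fst.comp measurable_fst)).edist (hf.comp measurable_snd)
    exact h3.indicator (measurable_snd hU)
  rw [funext h1]
  exact h2.div (by fun_prop)

/-- The hypothesis that `U` has lower density `κ` at scales at most one. -/
def LowerDensity (κ : ℝ≥0∞) (U : Set (EuclideanSpace ℝ (Fin d))) : Prop :=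
  ∀ x ∈ U, ∀ t : ℝ, 0 < t → t ≤ 1 → κ * ENNReal.ofReal t ^ d ≤ volume (Metric.ball x t ∩ U)

theorem edist_le_oscAverage_add (hf : Measurable f) {κ : ℝ≥0∞} (hκ0 : κ ≠ 0) (hκt : κ ≠ ⊤)
    (hκ : LowerDensity κ U) {a b y : EuclideanSpace ℝ (Fin d)} (hy : y ∈ U) {s R S : ℝ}
    (hs0 : 0 < s) (hs1 : s ≤ 1) (hR : dist y a + s ≤ R) (hR4 : R ≤ 4 * s)
    (hS : dist y b + s ≤ S) (hS4 : S ≤ 4 * s) :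
    edist (f a) (f b) ≤ κ⁻¹ * 4 ^ d * (oscAverage U f a R + oscAverage U f b S) := by
  have hs0' : ENNReal.ofReal s ^ d ≠ 0 := pow_ne_zero _ (by simpa using hs0)
  have hst : ENNReal.ofReal s ^ d ≠ ⊤ := ENNReal.pow_ne_top ofReal_ne_top
  have key : ∀ a R, dist y a + s ≤ R → R ≤ 4 * s →
      ∫⁻ z in Metric.ball y s ∩ U, edist (f a) (f z) ≤
        ENNReal.ofReal s ^ d * (4 ^ d * oscAverage U f a R) := by
    intro a R hR hR4
    have hR0 : 0 < R := by linarith [dist_nonneg (x := y) (y := a)]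
    have hRp : ENNReal.ofReal R ^ d ≠ 0 := pow_ne_zero _ (by simpa using hR0)
    calc ∫⁻ z in Metric.ball y s ∩ U, edist (f a) (f z)
        ≤ ∫⁻ z in Metric.ball a R ∩ U, edist (f a) (f z) := by
          refine lintegral_mono_set (inter_subset_inter_left _ ?_)
          exact Metric.ball_subset_ball' (by linarith)
      _ = ENNReal.ofReal R ^ d * oscAverage U f a R := by
          rw [oscAverage, ENNReal.mul_div_cancel hRp (ENNReal.pow_ne_top ofReal_ne_top)]
      _ ≤ ENNReal.ofReal (4 * s) ^ d * oscAverage U f a R := by gcongr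
      _ = _ := by
          rw [ENNReal.ofReal_mul (by norm_num), mul_pow, ENNReal.ofReal_ofNat]; ring
  have hmul : edist (f a) (f b) * (κ * ENNReal.ofReal s ^ d) ≤
      ENNReal.ofReal s ^ d * (4 ^ d * (oscAverage U f a R + oscAverage U f b S)) := by
    calc edist (f a) (f b) * (κ * ENNReal.ofReal s ^ d)
        ≤ edist (f a) (f b) * volume (Metric.ball y s ∩ U) := by
          gcongr; exact hκ y hy s hs0 hs1
      _ = ∫⁻ z in Metric.ball y s ∩ U, edist (f a) (f b) := by rw [setLIntegral_const]
      _ ≤ ∫⁻ z in Metric.ball y s ∩ U, (edist (f a) (f z) + edist (f b) (f z)) :=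
          lintegral_mono fun z => edist_triangle_right _ _ _
      _ = (∫⁻ z in Metric.ball y s ∩ U, edist (f a) (f z)) +
            ∫⁻ z in Metric.ball y s ∩ U, edist (f b) (f z) :=
          lintegral_add_left (measurable_const.edist hf) _
      _ ≤ _ := by
          rw [mul_add, mul_add]
          exact add_le_add (key a R hR hR4) (key b S hS hS4)
  have h2 : edist (f a) (f b) * κ ≤ 4 ^ d * (oscAverage U f a R + oscAverage U f b S) := by
    rw [← ENNReal.mul_le_mul_iff_right hs0' hst]
    refine le_trans (le_of_eq ?_) hmul
    ring
  calc edist (f a) (f b) = κ⁻¹ * (edist (f a) (f b) * κ) := by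
        rw [mul_comm (edist _ _), ← mul_assoc, ENNReal.inv_mul_cancel hκ0 hκt, one_mul]
    _ ≤ κ⁻¹ * (4 ^ d * (oscAverage U f a R + oscAverage U f b S)) := by gcongr
    _ = _ := by ring

/-- The averages of the oscillations of `f` at scale `ρ` over `B(y, ρ / 2) ∩ U`, in `L^r`. -/
def oscMean (U : Set (EuclideanSpace ℝ (Fin d))) (f : EuclideanSpace ℝ (Fin d) → ℝ) (r ρ : ℝ)
    (y : EuclideanSpace ℝ (Fin d)) : ℝ≥0∞ :=
  ballAverage (U.indicator fun z => oscAverage U f z ρ ^ r) y (ρ / 4) ^ (1 / r)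

theorem exists_oscAverage_le_oscMean (hU : MeasurableSet U) (hf : Measurable f) {κ : ℝ≥0∞}
    (hκ0 : κ ≠ 0) (hκ : LowerDensity κ U) {r : ℝ} (hr : 0 < r)
    {y : EuclideanSpace ℝ (Fin d)} (hy : y ∈ U) {ρ : ℝ} (hρ0 : 0 < ρ) (hρ1 : ρ ≤ 1) :
    ∃ z ∈ Metric.ball y (ρ / 2) ∩ U,
      oscAverage U f z ρ ≤ κ⁻¹ ^ (1 / r) * oscMean U f r ρ y := by
  have hA : Measurable fun z => oscAverage U f z ρ :=
    (measurable_oscAverage hU hf).of_uncurry_right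
  have hvol := hκ y hy (ρ / 2) (by positivity) (by linarith)
  have hρ2 : ENNReal.ofReal (ρ / 2) ^ d ≠ 0 := pow_ne_zero _ (by simpa using hρ0)
  have hρ4 : ENNReal.ofReal (ρ / 4) ^ d ≠ 0 := pow_ne_zero _ (by simpa using hρ0)
  have h0 : volume (Metric.ball y (ρ / 2) ∩ U) ≠ 0 := fun h => by
    rw [h] at hvol
    exact mul_ne_zero hκ0 hρ2 (le_antisymm hvol bot_le)
  have ht : volume (Metric.ball y (ρ / 2) ∩ U) ≠ ⊤ :=
    ((measure_mono inter_subset_left).trans_lt measure_ball_lt_top).ne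
  obtain ⟨z, hz, hle⟩ := exists_le_setLAverage h0 ht
    (hA.pow_const r).aemeasurable
  refine ⟨z, hz, ?_⟩
  have h1 : oscAverage U f z ρ ^ r ≤
      κ⁻¹ * ballAverage (U.indicator fun z => oscAverage U f z ρ ^ r) y (ρ / 4) := by
    refine hle.trans ?_
    rw [setLAverage_eq, ballAverage, show 2 * (ρ / 4) = ρ / 2 by ring,
      setLIntegral_indicator hU, inter_comm U, ENNReal.div_eq_inv_mul, ENNReal.div_eq_inv_mul,
      ← mul_assoc]
    gcongr
    rw [← ENNReal.mul_inv (Or.inl hκ0) (Or.inr hρ4)]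
    refine ENNReal.inv_le_inv.2 (le_trans ?_ hvol)
    gcongr
    norm_num
  calc oscAverage U f z ρ = (oscAverage U f z ρ ^ r) ^ (1 / r) := by
        rw [← ENNReal.rpow_mul, mul_one_div_cancel hr.ne', ENNReal.rpow_one]
    _ ≤ (κ⁻¹ * ballAverage (U.indicator fun z => oscAverage U f z ρ ^ r) y (ρ / 4)) ^ (1 / r) := by
        gcongr
    _ = _ := by rw [ENNReal.mul_rpow_of_nonneg _ _ (by positivity), oscMean]

theorem edist_le_sum_oscMean (hU : MeasurableSet U) (hf : Measurable f) {κ : ℝ≥0∞}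
    (hκ0 : κ ≠ 0) (hκt : κ ≠ ⊤) (hκ : LowerDensity κ U) {r : ℝ} (hr : 0 < r)
    {x y : EuclideanSpace ℝ (Fin d)} {t : ℝ} (ht0 : 0 < t) (ht1 : t ≤ 1)
    (hy : y ∈ Metric.ball x t ∩ U) (n : ℕ) :
    edist (f x) (f y) ≤ 2 * (κ⁻¹ * 4 ^ d) * (oscAverage U f x (2 * t) +
      κ⁻¹ ^ (1 / r) * ∑ k ∈ Finset.range (n + 1), oscMean U f r ((1 / 2) ^ k * t) y +
        oscAverage U f y ((1 / 2) ^ n * t / 2)) := by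
  have hρ0 : ∀ k : ℕ, 0 < (1 / 2 : ℝ) ^ k * t := fun k => by positivity
  have hρ1 : ∀ k : ℕ, (1 / 2 : ℝ) ^ k * t ≤ 1 := fun k =>
    mul_le_one₀ (pow_le_one₀ (by norm_num) (by norm_num)) ht0.le ht1
  choose z hz hzle using fun k : ℕ =>
    exists_oscAverage_le_oscMean hU hf hκ0 hκ hr hy.2 (hρ0 k) (hρ1 k)
  have hdist : ∀ k, dist y (z k) < (1 / 2 : ℝ) ^ k * t / 2 := fun k => by
    rw [dist_comm]; exact (hz k).1
  set K := κ⁻¹ * 4 ^ d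
  set A : ℕ → ℝ≥0∞ := fun k => oscAverage U f (z k) ((1 / 2) ^ k * t) with hA
  have hchain : ∀ n : ℕ, edist (f x) (f (z n)) + K * A n ≤
      2 * K * (oscAverage U f x (2 * t) + ∑ k ∈ Finset.range (n + 1), A k) := by
    intro n
    induction n with
    | zero =>
      have h1 : edist (f x) (f (z 0)) ≤ K * (oscAverage U f x (2 * t) + A 0) := by
        have hd := hdist 0
        have hyx : dist y x < t := hy.1
        refine edist_le_oscAverage_add hf hκ0 hκt hκ hy.2 (s := t / 2) (by positivity)
          (by linarith) (by linarith) (by linarith) ?_ ?_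
        · rw [pow_zero, one_mul] at *; linarith
        · rw [pow_zero, one_mul]; linarith
      calc edist (f x) (f (z 0)) + K * A 0
          ≤ K * (oscAverage U f x (2 * t) + A 0) + K * (oscAverage U f x (2 * t) + A 0) := by
            gcongr; exact le_add_self
        _ = _ := by simp only [zero_add, Finset.range_one, Finset.sum_singleton]; ring
    | succ n ih =>
      have h1 : edist (f (z n)) (f (z (n + 1))) ≤ K * (A n + A (n + 1)) := by
        have hd := hdist n
        have hd1 := hdist (n + 1)
        have hp : (1 / 2 : ℝ) ^ (n + 1) * t = (1 / 2 : ℝ) ^ n * t / 2 := by ring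
        have := hρ0 n
        have := hρ1 n
        refine edist_le_oscAverage_add hf hκ0 hκt hκ hy.2 (s := (1 / 2 : ℝ) ^ (n + 1) * t / 2)
          ?_ ?_ ?_ ?_ ?_ ?_ <;> linarith
      calc edist (f x) (f (z (n + 1))) + K * A (n + 1)
          ≤ (edist (f x) (f (z n)) + K * (A n + A (n + 1))) + K * A (n + 1) := by
            gcongr
            exact (edist_triangle _ _ _).trans (add_le_add_right h1 _)
        _ = (edist (f x) (f (z n)) + K * A n) + 2 * K * A (n + 1) := by ring
        _ ≤ 2 * K * (oscAverage U f x (2 * t) + ∑ k ∈ Finset.range (n + 1), A k) +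
              2 * K * A (n + 1) := by gcongr
        _ = _ := by rw [Finset.sum_range_succ _ (n + 1)]; ring
  have hlast : edist (f (z n)) (f y) ≤
      K * (A n + oscAverage U f y ((1 / 2) ^ n * t / 2)) := by
    have hd := hdist n
    have := hρ0 n
    have := hρ1 n
    refine edist_le_oscAverage_add hf hκ0 hκt hκ hy.2 (s := (1 / 2 : ℝ) ^ n * t / 2)
      ?_ ?_ ?_ ?_ ?_ ?_ <;> try rw [dist_self]
    all_goals linarith
  calc edist (f x) (f y)
      ≤ edist (f x) (f (z n)) + K * (A n + oscAverage U f y ((1 / 2) ^ n * t / 2)) :=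
        (edist_triangle _ _ _).trans (add_le_add_right hlast _)
    _ = (edist (f x) (f (z n)) + K * A n) + K * oscAverage U f y ((1 / 2) ^ n * t / 2) := by ring
    _ ≤ 2 * K * (oscAverage U f x (2 * t) + ∑ k ∈ Finset.range (n + 1), A k) +
          2 * K * oscAverage U f y ((1 / 2) ^ n * t / 2) := by
        gcongr
        · exact hchain n
        · rw [two_mul]; exact le_self_add
    _ ≤ 2 * K * (oscAverage U f x (2 * t) +
          κ⁻¹ ^ (1 / r) * ∑ k ∈ Finset.range (n + 1), oscMean U f r ((1 / 2) ^ k * t) y) +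
          2 * K * oscAverage U f y ((1 / 2) ^ n * t / 2) := by
        rw [Finset.mul_sum]
        gcongr with k
        exact hzle k
    _ = _ := by ring

theorem edist_le_tsum_oscMean (hU : MeasurableSet U) (hf : Measurable f) {κ : ℝ≥0∞}
    (hκ0 : κ ≠ 0) (hκt : κ ≠ ⊤) (hκ : LowerDensity κ U) {r : ℝ} (hr : 0 < r)
    {x y : EuclideanSpace ℝ (Fin d)} {t : ℝ} (ht0 : 0 < t) (ht1 : t ≤ 1)
    (hy : y ∈ Metric.ball x t ∩ U)
    (hlim : Filter.Tendsto (oscAverage U f y) (nhdsWithin 0 (Ioi 0)) (nhds 0)) :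
    edist (f x) (f y) ≤ 2 * (κ⁻¹ * 4 ^ d) * (oscAverage U f x (2 * t) +
      κ⁻¹ ^ (1 / r) * ∑' k, oscMean U f r ((1 / 2) ^ k * t) y) := by
  have hK : 2 * (κ⁻¹ * 4 ^ d) ≠ ⊤ := ENNReal.mul_ne_top (by norm_num)
    (ENNReal.mul_ne_top (ENNReal.inv_ne_top.2 hκ0) (ENNReal.pow_ne_top (by norm_num)))
  have hto : Filter.Tendsto (fun n : ℕ => (1 / 2 : ℝ) ^ n * t / 2) Filter.atTop
      (nhdsWithin 0 (Ioi 0)) := by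
    refine tendsto_nhdsWithin_iff.2 ⟨?_, Filter.Eventually.of_forall fun n => ?_⟩
    · have := ((tendsto_pow_atTop_nhds_zero_of_lt_one (r := (1 / 2 : ℝ)) (by norm_num)
        (by norm_num)).mul_const t).div_const 2
      simpa using this
    · have : 0 < (1 / 2 : ℝ) ^ n * t / 2 := by positivity
      exact this
  set B := oscAverage U f x (2 * t) + κ⁻¹ ^ (1 / r) * ∑' k, oscMean U f r ((1 / 2) ^ k * t) y
  have hle : ∀ n : ℕ, edist (f x) (f y) ≤
      2 * (κ⁻¹ * 4 ^ d) * (B + oscAverage U f y ((1 / 2) ^ n * t / 2)) := by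
    intro n
    refine (edist_le_sum_oscMean hU hf hκ0 hκt hκ hr ht0 ht1 hy n).trans ?_
    gcongr
    exact add_le_add_right (mul_le_mul_right (ENNReal.sum_le_tsum _) _) _
  have hT : Filter.Tendsto (fun n : ℕ =>
      2 * (κ⁻¹ * 4 ^ d) * (B + oscAverage U f y ((1 / 2) ^ n * t / 2))) Filter.atTop
      (nhds (2 * (κ⁻¹ * 4 ^ d) * (B + 0))) :=
    ENNReal.Tendsto.const_mul ((hlim.comp hto).const_add B) (Or.inr hK)
  rw [add_zero] at hT
  exact ge_of_tendsto' hT hle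

theorem ae_tendsto_oscAverage (hU : MeasurableSet U)
    (hloc : LocallyIntegrable (U.indicator f) volume) :
    ∀ᵐ y, y ∈ U → Filter.Tendsto (oscAverage U f y) (nhdsWithin 0 (Ioi 0)) (nhds 0) := by
  filter_upwards [VitaliFamily.ae_tendsto_lintegral_enorm_sub_div
    (Besicovitch.vitaliFamily volume) hloc] with y hy hyU
  have h1 := hy.comp (Besicovitch.tendsto_filterAt volume y)
  set v := volume (Metric.ball (0 : EuclideanSpace ℝ (Fin d)) 1)
  have h2 := ENNReal.Tendsto.const_mul (a := v) h1 (Or.inr volume_unit_ball_ne_top)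
  rw [mul_zero] at h2
  refine tendsto_of_tendsto_of_tendsto_of_le_of_le' tendsto_const_nhds h2
    (Filter.Eventually.of_forall fun _ => bot_le) ?_
  filter_upwards [self_mem_nhdsWithin] with s hs
  have hs0 : (0 : ℝ) < s := hs
  simp only [Function.comp_apply]
  rw [volume_closedBall_eq y hs0, mul_comm (ENNReal.ofReal s ^ d), ← mul_div_assoc,
    ENNReal.mul_div_mul_left _ _ volume_unit_ball_ne_zero volume_unit_ball_ne_top, oscAverage]
  refine ENNReal.div_le_div_right ?_ _
  calc ∫⁻ z in Metric.ball y s ∩ U, edist (f y) (f z)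
      = ∫⁻ z in Metric.ball y s ∩ U, ‖U.indicator f z - U.indicator f y‖ₑ := by
        refine setLIntegral_congr_fun (measurableSet_ball.inter hU) fun z hz => ?_
        simp only [indicator_of_mem hyU, indicator_of_mem hz.2, edist_comm (f y),
          edist_eq_enorm_sub]
    _ ≤ _ := lintegral_mono_set (inter_subset_left.trans Metric.ball_subset_closedBall)

end Chain

section Upper

variable {d : ℕ}

theorem eLpNorm_ballAverage_rpow_le {h : EuclideanSpace ℝ (Fin d) → ℝ≥0∞} (hh : Measurable h)
    {r : ℝ} (hr : 0 < r) {u : ℝ≥0∞} (hu : 1 ≤ u) (hru : ENNReal.ofReal r ≤ u)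
    (x : EuclideanSpace ℝ (Fin d)) {s t : ℝ} (hs : 0 < s) (hst : 2 * s ≤ t) :
    eLpNorm (fun y => ballAverage h y s ^ (1 / r)) u (volume.restrict (Metric.ball x t)) ≤
      (ENNReal.ofReal (t / s) ^ d * ballAverage h x t) ^ (1 / r - 1 / u.toReal) *
        (2 ^ d * volume (Metric.ball (0 : EuclideanSpace ℝ (Fin d)) 1) *
          (ENNReal.ofReal t ^ d * ballAverage h x t)) ^ (1 / u.toReal) := by
  have ht : 0 < t := by linarith
  have ht0 : ENNReal.ofReal t ^ d ≠ 0 := pow_ne_zero _ (by simpa using ht)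
  have htt : ENNReal.ofReal t ^ d ≠ ⊤ := ENNReal.pow_ne_top ofReal_ne_top
  set J := ballAverage h x t with hJ
  have hI : ∫⁻ z in Metric.ball x (2 * t), h z = ENNReal.ofReal t ^ d * J := by
    rw [hJ, ballAverage, ENNReal.mul_div_cancel ht0 htt]
  have hsub : ∀ y ∈ Metric.ball x t, Metric.ball y (2 * s) ⊆ Metric.ball x (2 * t) := by
    intro y hy
    have hyx : dist y x < t := hy
    exact Metric.ball_subset_ball' (by linarith)
  have hsup : ∀ y ∈ Metric.ball x t, ballAverage h y s ≤ ENNReal.ofReal (t / s) ^ d * J := by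
    intro y hy
    calc ballAverage h y s ≤ (∫⁻ z in Metric.ball x (2 * t), h z) / ENNReal.ofReal s ^ d := by
          refine ENNReal.div_le_div_right ?_ _
          exact lintegral_mono_set (hsub y hy)
      _ = _ := by
          rw [hI, ENNReal.ofReal_div_of_pos hs, ENNReal.div_eq_inv_mul, ENNReal.div_eq_inv_mul,
            mul_pow, ENNReal.inv_pow, mul_assoc]
  by_cases hut : u = ⊤
  · subst hut
    simp only [eLpNorm_exponent_top, eLpNormEssSup, enorm_eq_self, ENNReal.toReal_top, _root_.div_zero,
      sub_zero, ENNReal.rpow_zero, mul_one]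
    refine essSup_le_of_ae_le _ ?_
    filter_upwards [ae_restrict_mem measurableSet_ball] with y hy
    have := hsup y hy
    gcongr
  have hu0 : u ≠ 0 := (zero_lt_one.trans_le hu).ne'
  have hu' : 0 < u.toReal := ENNReal.toReal_pos hu0 hut
  have hru' : r ≤ u.toReal := (ENNReal.ofReal_le_iff_le_toReal hut).1 hru
  have hexp : 0 ≤ u.toReal / r - 1 := by rw [sub_nonneg, one_le_div hr]; exact hru'
  set w := (Metric.ball x (2 * t)).indicator h with hw
  have hwm : Measurable w := hh.indicator measurableSet_ball
  have hloc : ∀ y ∈ Metric.ball x t, ballAverage h y s = ballAverage w y s := by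
    intro y hy
    rw [ballAverage, ballAverage, hw, setLIntegral_indicator measurableSet_ball,
      inter_eq_right.2 (hsub y hy)]
  rw [eLpNorm_eq_lintegral_rpow_enorm_toReal hu0 hut]
  simp only [enorm_eq_self, ← ENNReal.rpow_mul]
  calc (∫⁻ y in Metric.ball x t, ballAverage h y s ^ (1 / r * u.toReal)) ^ (1 / u.toReal)
      ≤ ((ENNReal.ofReal (t / s) ^ d * J) ^ (u.toReal / r - 1) *
          (2 ^ d * volume (Metric.ball (0 : EuclideanSpace ℝ (Fin d)) 1) *
            (ENNReal.ofReal t ^ d * J))) ^ (1 / u.toReal) := by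
        refine ENNReal.rpow_le_rpow ?_ (by positivity)
        calc ∫⁻ y in Metric.ball x t, ballAverage h y s ^ (1 / r * u.toReal)
            ≤ ∫⁻ y in Metric.ball x t,
                (ENNReal.ofReal (t / s) ^ d * J) ^ (u.toReal / r - 1) * ballAverage w y s := by
              refine setLIntegral_mono_ae' measurableSet_ball (ae_of_all _ fun y hy => ?_)
              rw [← hloc y hy, show 1 / r * u.toReal = (u.toReal / r - 1) + 1 by ring,
                ENNReal.rpow_add_of_nonneg _ _ hexp zero_le_one, ENNReal.rpow_one]
              have := hsup y hy
              gcongr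
          _ ≤ ∫⁻ y, (ENNReal.ofReal (t / s) ^ d * J) ^ (u.toReal / r - 1) * ballAverage w y s :=
              setLIntegral_le_lintegral _ _
          _ = _ := by
              rw [lintegral_const_mul _ (measurable_ballAverage_left hwm s),
                lintegral_ballAverage hwm hs, hw, lintegral_indicator measurableSet_ball, hI]
    _ = _ := by
        rw [ENNReal.mul_rpow_of_nonneg _ _ (by positivity), ← ENNReal.rpow_mul]
        congr 2
        field_simp

variable {U : Set (EuclideanSpace ℝ (Fin d))} {f : EuclideanSpace ℝ (Fin d) → ℝ}

/-- The rescaled oscillation `t ^ (-σ) * oscAverage U f x t`, cut off to `x ∈ U`, `t ∈ (0, 1)`. -/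
def scaledOsc (U : Set (EuclideanSpace ℝ (Fin d))) (f : EuclideanSpace ℝ (Fin d) → ℝ) (σ : ℝ)
    (x : EuclideanSpace ℝ (Fin d)) (t : ℝ) : ℝ≥0∞ :=
  (U ×ˢ Ioo (0 : ℝ) 1).indicator
    (fun z => ENNReal.ofReal (z.2 ^ (-σ)) * oscAverage U f z.1 z.2) (x, t)

theorem measurable_scaledOsc (hU : MeasurableSet U) (hf : Measurable f) (σ : ℝ) :
    Measurable (Function.uncurry (scaledOsc U f σ)) := by
  refine Measurable.indicator ?_ (hU.prod measurableSet_Ioo)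
  exact Measurable.mul (by fun_prop) (measurable_oscAverage hU hf)

theorem scaledOsc_of_mem {σ : ℝ} {x : EuclideanSpace ℝ (Fin d)} {t : ℝ} (hx : x ∈ U)
    (ht : t ∈ Ioo (0 : ℝ) 1) :
    scaledOsc U f σ x t = ENNReal.ofReal (t ^ (-σ)) * oscAverage U f x t := by
  rw [scaledOsc, indicator_of_mem (mk_mem_prod hx ht)]

theorem scaledOsc_of_notMem_left {σ : ℝ} {x : EuclideanSpace ℝ (Fin d)} {t : ℝ} (hx : x ∉ U) :
    scaledOsc U f σ x t = 0 := by
  rw [scaledOsc, indicator_of_notMem fun h => hx h.1]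

theorem scaledOsc_of_notMem_right {σ : ℝ} {x : EuclideanSpace ℝ (Fin d)} {t : ℝ}
    (ht : t ∉ Ioo (0 : ℝ) 1) : scaledOsc U f σ x t = 0 := by
  rw [scaledOsc, indicator_of_notMem fun h => ht h.2]

theorem triebelInner_one {σ : ℝ} (x : EuclideanSpace ℝ (Fin d)) {t : ℝ} (ht : 0 < t) :
    triebelInner d U f σ 1 x t = ENNReal.ofReal (t ^ (-σ)) * oscAverage U f x t := by
  rw [triebelInner_eq le_rfl, eLpNorm_one_eq_lintegral_enorm, ENNReal.toReal_one, div_one,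
    oscAverage, neg_add, Real.rpow_add ht, ENNReal.ofReal_mul (by positivity), mul_assoc,
    Real.rpow_neg ht.le d, Real.rpow_natCast, ENNReal.ofReal_inv_of_pos (by positivity),
    ENNReal.ofReal_pow ht.le, ENNReal.div_eq_inv_mul]
  simp only [enorm_eq_self]

theorem mixedNorm_scaledOsc (hU : MeasurableSet U) {σ p : ℝ} (hp : 1 ≤ p) {q : ℝ≥0∞}
    (hq : 1 ≤ q) :
    mixedNorm (ENNReal.ofReal p) q unitInvMeasure (scaledOsc U f σ) =
      triebelSeminorm d U f σ 1 p q 1 := by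
  rw [triebelSeminorm_eq hU hp hq]
  have h : ∀ x, ∀ᵐ t ∂unitInvMeasure, scaledOsc U f σ x t =
      U.indicator (fun x => triebelInner d U f σ 1 x t) x := fun x => by
    filter_upwards [ae_unitInvMeasure_mem] with t ht
    by_cases hx : x ∈ U
    · rw [scaledOsc_of_mem hx ht, indicator_of_mem hx, triebelInner_one x ht.1]
    · rw [scaledOsc_of_notMem_left hx, indicator_of_notMem hx]
  refine le_antisymm (mixedNorm_mono (ae_of_all _ fun x => ?_))
    (mixedNorm_mono (ae_of_all _ fun x => ?_))
  · exact (h x).mono fun t ht => ht.le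
  · exact (h x).mono fun t ht => ht.ge

theorem eLpNorm_oscMean_le (hU : MeasurableSet U) (hf : Measurable f) {σ r : ℝ} (hr : 0 < r)
    {u : ℝ≥0∞} (hu : 1 ≤ u) (hru : ENNReal.ofReal r ≤ u) (x : EuclideanSpace ℝ (Fin d)) {t : ℝ}
    (ht : t ∈ Ioo (0 : ℝ) 1) (k : ℕ) :
    ENNReal.ofReal (t ^ (-(σ + (d : ℝ) / u.toReal))) *
        eLpNorm (oscMean U f r ((1 / 2) ^ k * t)) u (volume.restrict (Metric.ball x t)) ≤
      (4 ^ d) ^ (1 / r - 1 / u.toReal) *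
        (2 ^ d * volume (Metric.ball (0 : EuclideanSpace ℝ (Fin d)) 1)) ^ (1 / u.toReal) *
        ENNReal.ofReal (2 ^ (d / r - d / u.toReal - σ)) ^ k *
        ballAverage (fun y => scaledOsc U f σ y ((1 / 2) ^ k * t) ^ r) x t ^ (1 / r) := by
  obtain ⟨ht0, ht1⟩ := ht
  set ρ := (1 / 2 : ℝ) ^ k * t with hρ
  have hρ0 : 0 < ρ := by positivity
  have hρt : ρ ≤ t := mul_le_of_le_one_left ht0.le (pow_le_one₀ (by norm_num) (by norm_num))
  have hρ1 : ρ ∈ Ioo (0 : ℝ) 1 := ⟨hρ0, by linarith⟩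
  have hA : Measurable fun z => oscAverage U f z ρ :=
    (measurable_oscAverage hU hf).of_uncurry_right
  set h := U.indicator fun z => oscAverage U f z ρ ^ r with hh
  have hhm : Measurable h := (hA.pow_const r).indicator hU
  have hexp : 0 ≤ 1 / r - 1 / u.toReal := by
    by_cases hut : u = ⊤
    · simp [hut, hr.le]
    · rw [sub_nonneg]
      exact one_div_le_one_div_of_le hr ((ENNReal.ofReal_le_iff_le_toReal hut).1 hru)
  have hu0 : 0 ≤ 1 / u.toReal := by positivity
  set J := ballAverage h x t with hJ
  set V := ballAverage (fun y => scaledOsc U f σ y ρ ^ r) x t with hV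
  set v := volume (Metric.ball (0 : EuclideanSpace ℝ (Fin d)) 1)
  have hJV : J ^ (1 / r) = ENNReal.ofReal (ρ ^ σ) * V ^ (1 / r) := by
    have h1 : ∀ y, h y = ENNReal.ofReal (ρ ^ σ) ^ r * scaledOsc U f σ y ρ ^ r := by
      intro y
      by_cases hy : y ∈ U
      · rw [hh, indicator_of_mem hy, scaledOsc_of_mem hy hρ1, ← ENNReal.mul_rpow_of_nonneg _ _ hr.le,
          ← mul_assoc, ← ENNReal.ofReal_mul (by positivity), ← Real.rpow_add hρ0, add_neg_cancel,
          Real.rpow_zero, ENNReal.ofReal_one, one_mul]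
      · rw [hh, indicator_of_notMem hy, scaledOsc_of_notMem_left hy, ENNReal.zero_rpow_of_pos hr,
          mul_zero]
    have hsm : Measurable fun y => scaledOsc U f σ y ρ ^ r :=
      ((measurable_scaledOsc hU hf σ).of_uncurry_right).pow_const r
    have h2 : J = ENNReal.ofReal (ρ ^ σ) ^ r * V := by
      rw [hJ, hV, ballAverage, ballAverage, ← mul_div_assoc, ← lintegral_const_mul _ hsm]
      simp only [h1]
    rw [h2, ENNReal.mul_rpow_of_nonneg _ _ (by positivity), ← ENNReal.rpow_mul,
      mul_one_div_cancel hr.ne', ENNReal.rpow_one]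
  have hmain := eLpNorm_ballAverage_rpow_le hhm hr hu hru x (s := ρ / 4) (t := t) (by positivity)
    (by linarith)
  have hts : t / (ρ / 4) = 4 * 2 ^ k := by
    rw [hρ, one_div, inv_pow]; field_simp
  rw [hts, ← hJ] at hmain
  have hpow : (ENNReal.ofReal (4 * 2 ^ k) ^ d * J) ^ (1 / r - 1 / u.toReal) *
      (2 ^ d * v * (ENNReal.ofReal t ^ d * J)) ^ (1 / u.toReal) =
      (4 ^ d) ^ (1 / r - 1 / u.toReal) * (2 ^ d * v) ^ (1 / u.toReal) *
        (ENNReal.ofReal ((2 ^ (d / r - d / u.toReal)) ^ k) *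
          ENNReal.ofReal (t ^ (d / u.toReal))) * J ^ (1 / r) := by
    have hJ' : J ^ (1 / r) = J ^ (1 / r - 1 / u.toReal) * J ^ (1 / u.toReal) := by
      rw [← ENNReal.rpow_add_of_nonneg _ _ hexp hu0, sub_add_cancel]
    have h2 : (ENNReal.ofReal (2 ^ k) ^ d) ^ (1 / r - 1 / u.toReal) =
        ENNReal.ofReal ((2 ^ (d / r - d / u.toReal)) ^ k) := by
      rw [← ENNReal.ofReal_pow (by positivity), ENNReal.ofReal_rpow_of_nonneg (by positivity) hexp]
      congr 1
      rw [← pow_mul, ← Real.rpow_natCast, ← Real.rpow_natCast, ← Real.rpow_mul (by norm_num),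
        ← Real.rpow_mul (by norm_num)]
      congr 1
      push_cast
      ring
    have h3 : (ENNReal.ofReal t ^ d) ^ (1 / u.toReal) = ENNReal.ofReal (t ^ (d / u.toReal)) := by
      rw [← ENNReal.ofReal_pow ht0.le, ENNReal.ofReal_rpow_of_nonneg (by positivity) hu0]
      congr 1
      rw [← Real.rpow_natCast, ← Real.rpow_mul ht0.le, mul_one_div]
    rw [ENNReal.ofReal_mul (by norm_num), mul_pow, ENNReal.ofReal_ofNat]
    simp only [ENNReal.mul_rpow_of_nonneg _ _ hexp, ENNReal.mul_rpow_of_nonneg _ _ hu0]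
    rw [h2, h3, hJ']
    ring
  rw [hpow, hJV] at hmain
  have hscal : t ^ (-(σ + (d : ℝ) / u.toReal)) *
      ((2 ^ (d / r - d / u.toReal)) ^ k * t ^ (d / u.toReal) * ρ ^ σ) =
      (2 ^ (d / r - d / u.toReal - σ)) ^ k := by
    have h1 : ρ ^ σ = (2 ^ (-σ)) ^ k * t ^ σ := by
      rw [hρ, Real.mul_rpow (by positivity) ht0.le, one_div, inv_pow,
        Real.inv_rpow (by positivity), ← Real.rpow_neg (by positivity), ← Real.rpow_natCast,
        ← Real.rpow_natCast, ← Real.rpow_mul (by norm_num), ← Real.rpow_mul (by norm_num),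
        mul_comm (k : ℝ)]
    have h2 : t ^ (-(σ + (d : ℝ) / u.toReal)) * (t ^ (d / u.toReal) * t ^ σ) = 1 := by
      rw [← Real.rpow_add ht0, ← Real.rpow_add ht0, add_comm σ, neg_add_cancel, Real.rpow_zero]
    rw [h1, sub_eq_add_neg _ σ, Real.rpow_add (by norm_num), mul_pow]
    linear_combination ((2 ^ (d / r - d / u.toReal)) ^ k * ((2:ℝ) ^ (-σ)) ^ k) * h2
  calc ENNReal.ofReal (t ^ (-(σ + (d : ℝ) / u.toReal))) *
        eLpNorm (oscMean U f r ρ) u (volume.restrict (Metric.ball x t))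
      ≤ ENNReal.ofReal (t ^ (-(σ + (d : ℝ) / u.toReal))) *
        ((4 ^ d) ^ (1 / r - 1 / u.toReal) * (2 ^ d * v) ^ (1 / u.toReal) *
        (ENNReal.ofReal ((2 ^ (d / r - d / u.toReal)) ^ k) *
          ENNReal.ofReal (t ^ (d / u.toReal))) * (ENNReal.ofReal (ρ ^ σ) * V ^ (1 / r))) := by
        gcongr
        exact hmain
    _ = _ := by
        rw [← ENNReal.ofReal_pow (by positivity), ← hscal, ENNReal.ofReal_mul (by positivity),
          ENNReal.ofReal_mul (by positivity), ENNReal.ofReal_mul (by positivity)]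
        ring

end Upper

section Pointwise

variable {d : ℕ} {U : Set (EuclideanSpace ℝ (Fin d))} {f : EuclideanSpace ℝ (Fin d) → ℝ}

theorem measurable_oscMean (hU : MeasurableSet U) (hf : Measurable f) (r ρ : ℝ) :
    Measurable (oscMean U f r ρ) := by
  have hA : Measurable fun z => oscAverage U f z ρ :=
    (measurable_oscAverage hU hf).of_uncurry_right
  exact (measurable_ballAverage_left ((hA.pow_const r).indicator hU) _).pow_const _

theorem ofReal_mul_volume_ball_rpow (x : EuclideanSpace ℝ (Fin d)) {σ s t : ℝ} (ht : 0 < t)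
    (hs : 0 ≤ s) :
    ENNReal.ofReal (t ^ (-(σ + d * s))) * volume (Metric.ball x t) ^ s =
      volume (Metric.ball (0 : EuclideanSpace ℝ (Fin d)) 1) ^ s * ENNReal.ofReal (t ^ (-σ)) := by
  have h : t ^ (-(σ + d * s)) * t ^ (d * s) = t ^ (-σ) := by
    rw [← Real.rpow_add ht]; congr 1; ring
  rw [volume_ball_eq x ht, ENNReal.mul_rpow_of_nonneg _ _ hs, ← ENNReal.ofReal_pow ht.le,
    ENNReal.ofReal_rpow_of_nonneg (by positivity) hs, ← Real.rpow_natCast, ← Real.rpow_mul ht.le,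
    ← h, ENNReal.ofReal_mul (by positivity)]
  ring

/-- Monotonicity of the inner quantity in the auxiliary index. -/
theorem triebelInner_one_le (hf : Measurable f) {σ : ℝ} {u : ℝ≥0∞} (hu : 1 ≤ u)
    (x : EuclideanSpace ℝ (Fin d)) {t : ℝ} (ht : 0 < t) :
    triebelInner d U f σ 1 x t ≤
      volume (Metric.ball (0 : EuclideanSpace ℝ (Fin d)) 1) ^ (1 - 1 / u.toReal) *
        triebelInner d U f σ u x t := by
  have hexp : 0 ≤ 1 - 1 / u.toReal := by
    by_cases hut : u = ⊤
    · simp [hut]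
    · rw [sub_nonneg]
      have : 1 ≤ u.toReal := by
        simpa using (ENNReal.toReal_le_toReal one_ne_top hut).2 hu
      exact div_le_one_of_le₀ this (by positivity)
  have hm : Measurable fun y => edist (f x) (f y) := measurable_const.edist hf
  have h := eLpNorm_le_eLpNorm_mul_rpow_measure_univ hu
    (hm.aestronglyMeasurable (μ := volume.restrict (Metric.ball x t ∩ U)))
  rw [triebelInner_eq le_rfl, triebelInner_eq hu]
  have h2 : (volume.restrict (Metric.ball x t ∩ U)) univ ≤ volume (Metric.ball x t) := by
    rw [Measure.restrict_apply_univ]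
    exact measure_mono inter_subset_left
  have hk := ofReal_mul_volume_ball_rpow x (σ := σ + d / u.toReal) ht hexp
  rw [ENNReal.toReal_one, div_one] at *
  calc ENNReal.ofReal (t ^ (-(σ + (d : ℝ)))) *
        eLpNorm (fun y => edist (f x) (f y)) 1 (volume.restrict (Metric.ball x t ∩ U))
      ≤ ENNReal.ofReal (t ^ (-(σ + (d : ℝ)))) *
        (eLpNorm (fun y => edist (f x) (f y)) u (volume.restrict (Metric.ball x t ∩ U)) *
          volume (Metric.ball x t) ^ (1 - 1 / u.toReal)) := by
        gcongr
        refine h.trans ?_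
        gcongr
    _ = (ENNReal.ofReal (t ^ (-(σ + d / u.toReal + d * (1 - 1 / u.toReal)))) *
        volume (Metric.ball x t) ^ (1 - 1 / u.toReal)) *
        eLpNorm (fun y => edist (f x) (f y)) u (volume.restrict (Metric.ball x t ∩ U)) := by
        rw [show σ + d / u.toReal + d * (1 - 1 / u.toReal) = σ + d by ring]
        ring
    _ = _ := by rw [hk]; ring

/-- The rescaled oscillation at double scale, cut off to `x ∈ U`, `t ∈ (0, 1)`. -/
def doubledOsc (U : Set (EuclideanSpace ℝ (Fin d))) (f : EuclideanSpace ℝ (Fin d) → ℝ) (σ : ℝ)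
    (x : EuclideanSpace ℝ (Fin d)) (t : ℝ) : ℝ≥0∞ :=
  (U ×ˢ Ioo (0 : ℝ) 1).indicator
    (fun z => ENNReal.ofReal (z.2 ^ (-σ)) * oscAverage U f z.1 (2 * z.2)) (x, t)

theorem measurable_doubledOsc (hU : MeasurableSet U) (hf : Measurable f) (σ : ℝ) :
    Measurable (Function.uncurry (doubledOsc U f σ)) := by
  refine Measurable.indicator ?_ (hU.prod measurableSet_Ioo)
  have h : Measurable fun z : EuclideanSpace ℝ (Fin d) × ℝ => oscAverage U f z.1 (2 * z.2) :=
    (measurable_oscAverage hU hf).comp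
      (measurable_fst.prodMk (measurable_snd.const_mul (2 : ℝ)))
  exact Measurable.mul (by fun_prop) h

/-- The inner quantity is controlled by oscillations over balls with dyadic radii. -/
theorem triebelInner_le (hU : MeasurableSet U) (hf : Measurable f) {κ : ℝ≥0∞} (hκ0 : κ ≠ 0)
    (hκt : κ ≠ ⊤) (hκ : LowerDensity κ U) {σ r : ℝ} (hr : 0 < r) {u : ℝ≥0∞} (hu : 1 ≤ u)
    (hru : ENNReal.ofReal r ≤ u)
    (hlim : ∀ᵐ y, y ∈ U → Filter.Tendsto (oscAverage U f y) (nhdsWithin 0 (Ioi 0)) (nhds 0))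
    {x : EuclideanSpace ℝ (Fin d)} (hx : x ∈ U) {t : ℝ} (ht : t ∈ Ioo (0 : ℝ) 1) :
    triebelInner d U f σ u x t ≤
      2 * (κ⁻¹ * 4 ^ d) * (volume (Metric.ball (0 : EuclideanSpace ℝ (Fin d)) 1) ^ (1 / u.toReal) *
        doubledOsc U f σ x t + κ⁻¹ ^ (1 / r) * ∑' k : ℕ, (4 ^ d) ^ (1 / r - 1 / u.toReal) *
        (2 ^ d * volume (Metric.ball (0 : EuclideanSpace ℝ (Fin d)) 1)) ^ (1 / u.toReal) *
        ENNReal.ofReal (2 ^ (d / r - d / u.toReal - σ)) ^ k *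
        ballAverage (fun y => scaledOsc U f σ y ((1 / 2) ^ k * t) ^ r) x t ^ (1 / r)) := by
  have hu0 : u ≠ 0 := (zero_lt_one.trans_le hu).ne'
  have hμ : volume.restrict (Metric.ball x t) ≠ 0 := by
    rw [Ne, Measure.restrict_eq_zero]
    exact (Metric.measure_ball_pos volume x ht.1).ne'
  set μ := volume.restrict (Metric.ball x t) with hμd
  set D := 2 * (κ⁻¹ * 4 ^ d) with hD
  set b := κ⁻¹ ^ (1 / r) with hb
  set a := oscAverage U f x (2 * t) with ha
  set s := ENNReal.ofReal (t ^ (-(σ + (d : ℝ) / u.toReal))) with hs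
  have hm : ∀ k : ℕ, Measurable (oscMean U f r ((1 / 2) ^ k * t)) := fun k =>
    measurable_oscMean hU hf _ _
  have hms : Measurable fun y => ∑' k : ℕ, oscMean U f r ((1 / 2) ^ k * t) y := .tsum hm
  have hms' : Measurable fun y => b * ∑' k : ℕ, oscMean U f r ((1 / 2) ^ k * t) y :=
    hms.const_mul b
  have h1 : eLpNorm (fun y => edist (f x) (f y)) u (volume.restrict (Metric.ball x t ∩ U)) ≤
      eLpNorm (fun y => D * (a + b * ∑' k : ℕ, oscMean U f r ((1 / 2) ^ k * t) y)) u μ := by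
    refine (eLpNorm_mono_enorm_ae
      (g := fun y => D * (a + b * ∑' k : ℕ, oscMean U f r ((1 / 2) ^ k * t) y)) ?_).trans
      (eLpNorm_mono_measure _ (Measure.restrict_mono inter_subset_left le_rfl))
    filter_upwards [ae_restrict_mem (measurableSet_ball.inter hU), ae_restrict_of_ae hlim]
      with y hy hly
    simp only [enorm_eq_self]
    exact edist_le_tsum_oscMean hU hf hκ0 hκt hκ hr ht.1 ht.2.le hy (hly hy.2)
  have h2 : eLpNorm (fun y => D * (a + b * ∑' k : ℕ, oscMean U f r ((1 / 2) ^ k * t) y)) u μ ≤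
      D * (a * μ univ ^ (1 / u.toReal) +
        b * ∑' k : ℕ, eLpNorm (oscMean U f r ((1 / 2) ^ k * t)) u μ) := by
    refine (eLpNorm_const_mul_le D (measurable_const.add hms')).trans ?_
    gcongr
    refine (eLpNorm_add_le (f := fun _ => a) aestronglyMeasurable_const
      hms'.aestronglyMeasurable hu).trans ?_
    refine add_le_add ?_ ?_
    · rw [eLpNorm_const a hu0 hμ, enorm_eq_self]
    · refine (eLpNorm_const_mul_le b hms).trans ?_
      gcongr
      exact eLpNorm_tsum_le hu hm
  have h3 : s * (a * μ univ ^ (1 / u.toReal)) =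
      volume (Metric.ball (0 : EuclideanSpace ℝ (Fin d)) 1) ^ (1 / u.toReal) *
        doubledOsc U f σ x t := by
    have := ofReal_mul_volume_ball_rpow x (σ := σ) (s := 1 / u.toReal) ht.1 (by positivity)
    rw [doubledOsc, indicator_of_mem (mk_mem_prod hx ht), hμd, Measure.restrict_apply_univ,
      ← mul_assoc _ _ (oscAverage _ _ _ _), ← this, hs, mul_one_div]
    ring
  rw [triebelInner_eq hu]
  calc s * eLpNorm (fun y => edist (f x) (f y)) u (volume.restrict (Metric.ball x t ∩ U))
      ≤ s * (D * (a * μ univ ^ (1 / u.toReal) +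
        b * ∑' k : ℕ, eLpNorm (oscMean U f r ((1 / 2) ^ k * t)) u μ)) :=
        mul_le_mul_right (h1.trans h2) _
    _ = D * (s * (a * μ univ ^ (1 / u.toReal)) +
        b * ∑' k : ℕ, s * eLpNorm (oscMean U f r ((1 / 2) ^ k * t)) u μ) := by
        rw [ENNReal.tsum_mul_left]
        ring
    _ ≤ _ := by
        rw [h3]
        refine mul_le_mul_right (add_le_add le_rfl (mul_le_mul_right
          (ENNReal.tsum_le_tsum fun k => ?_) _)) _
        exact eLpNorm_oscMean_le hU hf hr hu hru x ht k

end Pointwise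

section DoubledOsc

variable {d : ℕ} {U : Set (EuclideanSpace ℝ (Fin d))} {f : EuclideanSpace ℝ (Fin d) → ℝ}

theorem eLpNorm_ballAverage_le {w : EuclideanSpace ℝ (Fin d) → ℝ≥0∞} (hw : Measurable w) {p : ℝ}
    (hp : 1 ≤ p) {t : ℝ} (ht : 0 < t) :
    eLpNorm (fun x => ballAverage w x t) (ENNReal.ofReal p) volume ≤
      2 ^ d * volume (Metric.ball (0 : EuclideanSpace ℝ (Fin d)) 1) *
        eLpNorm w (ENNReal.ofReal p) volume := by
  set A := 2 ^ d * volume (Metric.ball (0 : EuclideanSpace ℝ (Fin d)) 1) with hA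
  have hA0 : A ≠ 0 := mul_ne_zero (by simp) volume_unit_ball_ne_zero
  have hAt : A ≠ ⊤ := ENNReal.mul_ne_top (by simp) volume_unit_ball_ne_top
  have hp0 : 0 < p := by linarith
  rw [eLpNorm_eq_lintegral_rpow_enorm_toReal (by simpa using hp0) ofReal_ne_top,
    eLpNorm_eq_lintegral_rpow_enorm_toReal (by simpa using hp0) ofReal_ne_top,
    ENNReal.toReal_ofReal hp0.le]
  simp only [enorm_eq_self]
  have h : ∫⁻ x, ballAverage w x t ^ p ≤ A ^ p * ∫⁻ x, w x ^ p := by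
    rcases hp.eq_or_lt with rfl | hp1
    · simp only [ENNReal.rpow_one]
      exact (lintegral_ballAverage hw ht).le
    · have hwp : Measurable fun y => w y ^ p := hw.pow_const p
      calc ∫⁻ x, ballAverage w x t ^ p
          ≤ ∫⁻ x, A ^ (p - 1) * ballAverage (fun y => w y ^ p) x t :=
            lintegral_mono fun x => ballAverage_rpow_le hp1 hw x ht
        _ = A ^ (p - 1) * A * ∫⁻ x, w x ^ p := by
            rw [lintegral_const_mul _ (measurable_ballAverage_left hwp t),
              lintegral_ballAverage hwp ht, mul_assoc (A ^ (p - 1))]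
        _ = A ^ p * ∫⁻ x, w x ^ p := by
            congr 1
            conv_rhs => rw [← sub_add_cancel p 1, ENNReal.rpow_add _ _ hA0 hAt, ENNReal.rpow_one]
  calc (∫⁻ x, ballAverage w x t ^ p) ^ (1 / p) ≤ (A ^ p * ∫⁻ x, w x ^ p) ^ (1 / p) :=
        ENNReal.rpow_le_rpow h (by positivity)
    _ = _ := by
        rw [ENNReal.mul_rpow_of_nonneg _ _ (by positivity), ← ENNReal.rpow_mul,
          mul_one_div_cancel hp0.ne', ENNReal.rpow_one]

theorem oscAverage_le_of_mem (hU : MeasurableSet U) (hf : Measurable f)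
    {x : EuclideanSpace ℝ (Fin d)} (hx : x ∈ U) {s : ℝ} (hs1 : 1 ≤ s) (hs2 : s ≤ 2) :
    oscAverage U f x s ≤ volume (Metric.ball (0 : EuclideanSpace ℝ (Fin d)) 1) *
      U.indicator (fun x => ‖f x‖ₑ) x + ballAverage (U.indicator fun x => ‖f x‖ₑ) x 1 := by
  set F := U.indicator fun x => ‖f x‖ₑ with hF
  have hs0 : 0 < s := by linarith
  have hs0' : ENNReal.ofReal s ^ d ≠ 0 := pow_ne_zero _ (by simpa using hs0)
  have hst : ENNReal.ofReal s ^ d ≠ ⊤ := ENNReal.pow_ne_top ofReal_ne_top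
  have hFm : Measurable F := hf.enorm.indicator hU
  have h1 : ∫⁻ y in Metric.ball x s ∩ U, edist (f x) (f y) ≤
      F x * volume (Metric.ball x s) + ∫⁻ y in Metric.ball x s, F y := by
    calc ∫⁻ y in Metric.ball x s ∩ U, edist (f x) (f y)
        ≤ ∫⁻ y in Metric.ball x s ∩ U, (F x + F y) := by
          refine setLIntegral_mono_ae' (measurableSet_ball.inter hU) (ae_of_all _ fun y hy => ?_)
          rw [hF, indicator_of_mem hx, indicator_of_mem hy.2, edist_eq_enorm_sub]
          exact enorm_sub_le
      _ ≤ ∫⁻ y in Metric.ball x s, (F x + F y) := lintegral_mono_set inter_subset_left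
      _ = _ := by
          rw [lintegral_add_left measurable_const, setLIntegral_const]
  rw [oscAverage]
  calc (∫⁻ y in Metric.ball x s ∩ U, edist (f x) (f y)) / ENNReal.ofReal s ^ d
      ≤ (F x * volume (Metric.ball x s) + ∫⁻ y in Metric.ball x s, F y) /
        ENNReal.ofReal s ^ d := ENNReal.div_le_div_right h1 _
    _ = volume (Metric.ball (0 : EuclideanSpace ℝ (Fin d)) 1) * F x +
        (∫⁻ y in Metric.ball x s, F y) / ENNReal.ofReal s ^ d := by
        rw [ENNReal.add_div, volume_ball_eq x hs0, mul_left_comm, mul_comm _ (F x * _),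
          ENNReal.mul_div_cancel_right hs0' hst, mul_comm (F x)]
    _ ≤ _ := by
        refine add_le_add le_rfl ?_
        rw [ballAverage, ENNReal.ofReal_one, one_pow, div_one]
        refine (ENNReal.div_le_of_le_mul ?_).trans (lintegral_mono_set
          (Metric.ball_subset_ball (by linarith : s ≤ 2 * 1)))
        exact le_mul_of_one_le_right' (one_le_pow₀ (by simpa using hs1))

theorem unitInvMeasure_Ico_ne_top : unitInvMeasure (Ico (1 / 2) 1) ≠ ⊤ := by
  rw [← lintegral_indicator_one measurableSet_Ico, lintegral_unitInvMeasure]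
  refine ne_top_of_le_ne_top (b := ∫⁻ _ in Ioo (0 : ℝ) 1, 2) (by simp) ?_
  refine lintegral_mono fun t => ?_
  by_cases ht : t ∈ Ico (1 / 2 : ℝ) 1
  · rw [indicator_of_mem ht, Pi.one_apply, one_mul, ← ENNReal.ofReal_ofNat]
    refine ENNReal.ofReal_le_ofReal ?_
    exact inv_le_of_inv_le₀ (by norm_num) (by norm_num at ht ⊢; exact ht.1)
  · rw [indicator_of_notMem ht, zero_mul]
    exact zero_le

theorem mixedNorm_doubledOsc_le (hU : MeasurableSet U) (hf : Measurable f) {σ p : ℝ}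
    (hσ : 0 < σ) (hp : 1 ≤ p) {q : ℝ≥0∞} (hq : 1 ≤ q) :
    mixedNorm (ENNReal.ofReal p) q unitInvMeasure (doubledOsc U f σ) ≤
      ENNReal.ofReal (2 ^ σ) * (triebelSeminorm d U f σ 1 p q 1 +
        unitInvMeasure (Ico (1 / 2) 1) ^ (1 / q.toReal) *
          ((volume (Metric.ball (0 : EuclideanSpace ℝ (Fin d)) 1) +
          2 ^ d * volume (Metric.ball (0 : EuclideanSpace ℝ (Fin d)) 1)) * lpNormOn d U f p)) := by
  have hp' : 1 ≤ ENNReal.ofReal p := by simpa using hp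
  set v := volume (Metric.ball (0 : EuclideanSpace ℝ (Fin d)) 1)
  set F := U.indicator fun x => ‖f x‖ₑ with hF
  have hFm : Measurable F := hf.enorm.indicator hU
  set H : EuclideanSpace ℝ (Fin d) → ℝ≥0∞ := fun x => v * F x + ballAverage F x 1 with hH
  have hb : Measurable fun x => ballAverage F x 1 := measurable_ballAverage_left hFm 1
  have hvF : Measurable fun x => v * F x := hFm.const_mul v
  have hHm : Measurable H := hvF.add hb
  set G : EuclideanSpace ℝ (Fin d) → ℝ → ℝ≥0∞ :=
    fun x t => (Ico (1 / 2 : ℝ) 1).indicator (fun _ => H x) t with hG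
  have hGm : Measurable (Function.uncurry G) := by
    have : Function.uncurry G = (Prod.snd ⁻¹' Ico (1 / 2 : ℝ) 1).indicator fun z => H z.1 := by
      ext z
      simp only [hG, Function.uncurry, indicator, mem_preimage]
    rw [this]
    exact (hHm.comp measurable_fst).indicator (measurable_snd measurableSet_Ico)
  have hS := measurable_scaledOsc hU hf σ
  have hS2 : Measurable (Function.uncurry fun x t => scaledOsc U f σ x (2 * t)) :=
    hS.comp (measurable_fst.prodMk (measurable_snd.const_mul (2 : ℝ)))
  have hGle : mixedNorm (ENNReal.ofReal p) q unitInvMeasure G ≤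
      unitInvMeasure (Ico (1 / 2) 1) ^ (1 / q.toReal) * ((v + 2 ^ d * v) * lpNormOn d U f p) := by
    calc mixedNorm (ENNReal.ofReal p) q unitInvMeasure G
        ≤ eLpNorm (fun x => unitInvMeasure (Ico (1 / 2) 1) ^ (1 / q.toReal) * H x)
          (ENNReal.ofReal p) volume := by
          refine eLpNorm_mono_enorm fun x => ?_
          simp only [enorm_eq_self]
          refine (eLpNorm_indicator_const_le (H x) q).trans ?_
          rw [enorm_eq_self, mul_comm]
      _ ≤ unitInvMeasure (Ico (1 / 2) 1) ^ (1 / q.toReal) *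
          eLpNorm H (ENNReal.ofReal p) volume := eLpNorm_const_mul_le _ hHm
      _ ≤ _ := by
          refine mul_le_mul_right ?_ _
          rw [lpNormOn_eq hU, ← hF, add_mul]
          refine (eLpNorm_add_le hvF.aestronglyMeasurable hb.aestronglyMeasurable hp').trans ?_
          exact add_le_add (eLpNorm_const_mul_le v hFm) (eLpNorm_ballAverage_le hFm hp one_pos)
  have hpt : ∀ x, ∀ᵐ t ∂unitInvMeasure, doubledOsc U f σ x t ≤
      ENNReal.ofReal (2 ^ σ) * (scaledOsc U f σ x (2 * t) + G x t) := fun x => by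
    filter_upwards [ae_unitInvMeasure_mem] with t ht
    by_cases hx : x ∈ U
    · rw [doubledOsc, indicator_of_mem (mk_mem_prod hx ht)]
      rcases lt_or_ge t (1 / 2) with h | h
      · have ht2 : 2 * t ∈ Ioo (0 : ℝ) 1 := ⟨by linarith [ht.1], by linarith⟩
        have e : t ^ (-σ) = 2 ^ σ * (2 * t) ^ (-σ) := by
          rw [Real.mul_rpow (by norm_num) ht.1.le, ← mul_assoc, ← Real.rpow_add (by norm_num),
            add_neg_cancel, Real.rpow_zero, one_mul]
        rw [scaledOsc_of_mem hx ht2, e, ENNReal.ofReal_mul (by positivity), mul_assoc]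
        exact mul_le_mul_right le_self_add _
      · have e : t ^ (-σ) ≤ 2 ^ σ := by
          rw [Real.rpow_neg ht.1.le, ← Real.inv_rpow ht.1.le]
          refine Real.rpow_le_rpow (by positivity [ht.1]) ?_ hσ.le
          exact inv_le_of_inv_le₀ (by norm_num) (by linarith)
        have hGx : G x t = H x := by
          simp only [hG]
          rw [indicator_of_mem (show t ∈ Ico (1 / 2 : ℝ) 1 from ⟨h, ht.2⟩)]
        rw [hGx]
        refine mul_le_mul' (ENNReal.ofReal_le_ofReal e) ?_
        exact (oscAverage_le_of_mem hU hf hx (by linarith) (by linarith [ht.2])).trans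
          le_add_self
    · rw [doubledOsc, indicator_of_notMem fun h => hx h.1]
      exact zero_le
  calc mixedNorm (ENNReal.ofReal p) q unitInvMeasure (doubledOsc U f σ)
      ≤ mixedNorm (ENNReal.ofReal p) q unitInvMeasure fun x t =>
        ENNReal.ofReal (2 ^ σ) * (scaledOsc U f σ x (2 * t) + G x t) :=
        mixedNorm_mono (ae_of_all _ hpt)
    _ ≤ ENNReal.ofReal (2 ^ σ) * mixedNorm (ENNReal.ofReal p) q unitInvMeasure fun x t =>
        scaledOsc U f σ x (2 * t) + G x t := mixedNorm_const_mul_le _ (hS2.add hGm)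
    _ ≤ _ := by
        refine mul_le_mul_right ((mixedNorm_add_le hp' hq hS2 hGm).trans
          (add_le_add ?_ hGle)) _
        rw [← mixedNorm_scaledOsc hU hp hq]
        exact mixedNorm_comp_mul_left_le two_pos hS fun x t ht => scaledOsc_of_notMem_right ht

end DoubledOsc

theorem exists_averaging_exponent (d : ℕ) {p : ℝ} (hp : 1 ≤ p) {q : ℝ≥0∞} (hq : 1 ≤ q) {σ : ℝ}
    (hσ : 0 < σ) {u : ℝ≥0∞} (hu : 1 ≤ u)
    (hσu : (d : ℝ) / (min (ENNReal.ofReal p) q).toReal - (d : ℝ) / u.toReal < σ) :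
    ∃ r : ℝ, 0 < r ∧ r < p ∧ ENNReal.ofReal r < q ∧ ENNReal.ofReal r ≤ u ∧
      (d : ℝ) / r - (d : ℝ) / u.toReal < σ := by
  have hm1 : 1 ≤ min (ENNReal.ofReal p) q := le_min (by simpa using hp) hq
  have hmt : min (ENNReal.ofReal p) q ≠ ⊤ := ne_top_of_le_ne_top ofReal_ne_top (min_le_left _ _)
  have key : ∀ r : ℝ, 0 < r → ENNReal.ofReal r < min (ENNReal.ofReal p) q →
      r < p ∧ ENNReal.ofReal r < q := fun r hr h =>
    ⟨(ENNReal.ofReal_lt_ofReal_iff (by linarith)).1 (lt_min_iff.1 h).1, (lt_min_iff.1 h).2⟩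
  have hm0 : 0 < (min (ENNReal.ofReal p) q).toReal :=
    ENNReal.toReal_pos (zero_lt_one.trans_le hm1).ne' hmt
  rcases lt_or_ge u (min (ENNReal.ofReal p) q) with h | h
  · have hut : u ≠ ⊤ := h.ne_top
    have hu0 : 0 < u.toReal := ENNReal.toReal_pos (zero_lt_one.trans_le hu).ne' hut
    have hou : ENNReal.ofReal u.toReal = u := ENNReal.ofReal_toReal hut
    obtain ⟨h1, h2⟩ := key u.toReal hu0 (by rwa [hou])
    exact ⟨u.toReal, hu0, h1, h2, hou.le, by rwa [sub_self]⟩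
  · set m := (min (ENNReal.ofReal p) q).toReal with hm
    have hcont : ContinuousAt (fun r : ℝ => (d : ℝ) / r - (d : ℝ) / u.toReal) m :=
      (continuousAt_const.div continuousAt_id hm0.ne').sub continuousAt_const
    have hev := (hcont.eventually_lt continuousAt_const hσu).filter_mono
      (nhdsWithin_le_nhds (s := Iio m))
    obtain ⟨r, hr, hr0, hrm⟩ := (hev.and (Ioo_mem_nhdsLT hm0)).exists
    have hrm' : ENNReal.ofReal r < min (ENNReal.ofReal p) q :=
      (ENNReal.ofReal_lt_iff_lt_toReal hr0.le hmt).2 hrm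
    obtain ⟨h1, h2⟩ := key r hr0 hrm'
    exact ⟨r, hr0, h1, h2, hrm'.le.trans h, hr⟩

theorem IsCorkscrew.exists_lowerDensity (d : ℕ) {ε δ : ℝ} (hε : 0 < ε) (hδ : 0 < δ) :
    ∃ κ : ℝ≥0∞, κ ≠ 0 ∧ κ ≠ ⊤ ∧ ∀ Ω : Set (EuclideanSpace ℝ (Fin d)), IsCorkscrew d ε δ Ω →
      LowerDensity κ Ω := by
  have h : 0 < min 1 ε * (min 1 δ / 2) := by positivity
  refine ⟨ENNReal.ofReal (min 1 ε * (min 1 δ / 2)) ^ d *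
    volume (Metric.ball (0 : EuclideanSpace ℝ (Fin d)) 1), ?_, ?_, fun Ω hΩ x hx t ht0 ht1 =>
    hΩ.le_volume_ball_inter hε hδ hx ht0 ht1⟩
  · exact mul_ne_zero (pow_ne_zero _ (by simpa using h)) volume_unit_ball_ne_zero
  · exact ENNReal.mul_ne_top (ENNReal.pow_ne_top ofReal_ne_top) volume_unit_ball_ne_top

section Equivalence

variable {d : ℕ} {U : Set (EuclideanSpace ℝ (Fin d))} {f : EuclideanSpace ℝ (Fin d) → ℝ}

theorem ae_tendsto_oscAverage_of_lpNormOn_ne_top (hU : MeasurableSet U) (hf : Measurable f)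
    {p : ℝ} (hp : 1 ≤ p) (hfp : lpNormOn d U f p ≠ ⊤) :
    ∀ᵐ y, y ∈ U → Filter.Tendsto (oscAverage U f y) (nhdsWithin 0 (Ioi 0)) (nhds 0) := by
  have h : MemLp f (ENNReal.ofReal p) (volume.restrict U) :=
    ⟨hf.aestronglyMeasurable, lt_top_iff_ne_top.2 hfp⟩
  exact ae_tendsto_oscAverage hU
    (((memLp_indicator_iff_restrict hU).2 h).locallyIntegrable (by simpa using hp))

theorem measurable_triebelInner (hU : MeasurableSet U) (hf : Measurable f) {σ : ℝ} {u : ℝ≥0∞}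
    (hu : 1 ≤ u) :
    Measurable (Function.uncurry fun x t => triebelInner d U f σ u x t) := by
  set F : EuclideanSpace ℝ (Fin d) × ℝ → EuclideanSpace ℝ (Fin d) → ℝ≥0∞ := fun z =>
    (Metric.ball z.1 z.2 ∩ U).indicator fun y => edist (f z.1) (f y)
  have hF : Measurable (Function.uncurry F) := by
    have h : Function.uncurry F = {z : (EuclideanSpace ℝ (Fin d) × ℝ) × EuclideanSpace ℝ (Fin d) |
        dist z.2 z.1.1 < z.1.2 ∧ z.2 ∈ U}.indicator fun z => edist (f z.1.1) (f z.2) := by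
      ext z
      rfl
    rw [h]
    refine Measurable.indicator ?_ ?_
    · exact (hf.comp measurable_fst.fst).edist (hf.comp measurable_snd)
    · exact (measurableSet_lt (measurable_snd.dist measurable_fst.fst) measurable_fst.snd).inter
        (measurable_snd hU)
  have h : (Function.uncurry fun x t => triebelInner d U f σ u x t) = fun z =>
      ENNReal.ofReal (z.2 ^ (-(σ + (d : ℝ) / u.toReal))) * eLpNorm (F z) u volume := by
    ext z
    rw [Function.uncurry, triebelInner_eq hu,
      eLpNorm_indicator_eq_eLpNorm_restrict (measurableSet_ball.inter hU)]
  rw [h]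
  exact Measurable.mul (by fun_prop) (measurable_eLpNorm_right u hF)

theorem triebelSeminorm_one_le (hU : MeasurableSet U) (hf : Measurable f) {σ p : ℝ}
    (hp : 1 ≤ p) {q : ℝ≥0∞} (hq : 1 ≤ q) {u : ℝ≥0∞} (hu : 1 ≤ u) :
    triebelSeminorm d U f σ 1 p q 1 ≤
      volume (Metric.ball (0 : EuclideanSpace ℝ (Fin d)) 1) ^ (1 - 1 / u.toReal) *
        triebelSeminorm d U f σ 1 p q u := by
  rw [triebelSeminorm_eq hU hp hq, triebelSeminorm_eq hU hp hq]
  have hm : Measurable (Function.uncurry fun x t =>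
      U.indicator (fun x => triebelInner d U f σ u x t) x) :=
    (measurable_triebelInner hU hf hu).indicator (measurable_fst hU)
  refine le_trans (mixedNorm_mono (ae_of_all _ fun x => ?_)) (mixedNorm_const_mul_le _ hm)
  filter_upwards [ae_unitInvMeasure_mem] with t ht
  by_cases hx : x ∈ U
  · rw [indicator_of_mem hx, indicator_of_mem hx]
    exact triebelInner_one_le hf hu x ht.1
  · rw [indicator_of_notMem hx]
    exact zero_le

theorem triebelSeminorm_le {κ : ℝ≥0∞} (hκ0 : κ ≠ 0) (hκt : κ ≠ ⊤) {p : ℝ} (hp : 1 ≤ p)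
    {q : ℝ≥0∞} (hq : 1 ≤ q) {σ : ℝ} (hσ : 0 < σ) {u : ℝ≥0∞} (hu : 1 ≤ u)
    (hσu : (d : ℝ) / (min (ENNReal.ofReal p) q).toReal - (d : ℝ) / u.toReal < σ) :
    ∃ C : ℝ≥0∞, C ≠ ⊤ ∧ ∀ U : Set (EuclideanSpace ℝ (Fin d)), MeasurableSet U →
      LowerDensity κ U → ∀ f : EuclideanSpace ℝ (Fin d) → ℝ, Measurable f →
        lpNormOn d U f p ≠ ⊤ → triebelSeminorm d U f σ 1 p q u ≤
          C * (lpNormOn d U f p + triebelSeminorm d U f σ 1 p q 1) := by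
  obtain ⟨r, hr, hrp, hrq, hru, hrσ⟩ := exists_averaging_exponent d hp hq hσ hu hσu
  obtain ⟨A, hAt, hA⟩ := mixedNorm_ballAverage_le d hr hrp hrq
  have hp' : 1 ≤ ENNReal.ofReal p := by simpa using hp
  set v := volume (Metric.ball (0 : EuclideanSpace ℝ (Fin d)) 1)
  have hvt : v ≠ ⊤ := volume_unit_ball_ne_top
  set D := 2 * (κ⁻¹ * 4 ^ d)
  have hDt : D ≠ ⊤ := by finiteness
  set b := κ⁻¹ ^ (1 / r)
  have hbt : b ≠ ⊤ := ENNReal.rpow_ne_top_of_nonneg (by positivity) (by simpa using hκ0)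
  set c₁ := v ^ (1 / u.toReal)
  have hc₁ : c₁ ≠ ⊤ := ENNReal.rpow_ne_top_of_nonneg (by positivity) hvt
  set c₂ := ((4 : ℝ≥0∞) ^ d) ^ (1 / r - 1 / u.toReal) * (2 ^ d * v) ^ (1 / u.toReal)
  have hc₂ : c₂ ≠ ⊤ := by
    refine ENNReal.mul_ne_top ?_ ?_
    · rw [Ne, ENNReal.rpow_eq_top_iff]
      simp
    · exact ENNReal.rpow_ne_top_of_nonneg (by positivity) (ENNReal.mul_ne_top (by simp) hvt)
  set θ := ENNReal.ofReal (2 ^ ((d : ℝ) / r - d / u.toReal - σ))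
  have hθ : θ < 1 := by
    rw [← ENNReal.ofReal_one]
    refine (ENNReal.ofReal_lt_ofReal_iff one_pos).2 ?_
    exact Real.rpow_lt_one_of_one_lt_of_neg one_lt_two (by linarith)
  have hθt : (1 - θ)⁻¹ ≠ ⊤ := ENNReal.inv_ne_top.2 (tsub_pos_of_lt hθ).ne'
  set N := unitInvMeasure (Ico (1 / 2) 1) ^ (1 / q.toReal)
  have hNt : N ≠ ⊤ := ENNReal.rpow_ne_top_of_nonneg (by positivity) unitInvMeasure_Ico_ne_top
  set E := ENNReal.ofReal (2 ^ σ)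
  set K := N * (v + 2 ^ d * v)
  have hKt : K ≠ ⊤ := by finiteness
  refine ⟨D * (c₁ * (E * (1 + K)) + b * (c₂ * A * (1 - θ)⁻¹)), by finiteness, ?_⟩
  intro U hU hκ f hf hfp
  have hlim := ae_tendsto_oscAverage_of_lpNormOn_ne_top hU hf hp hfp
  set L := lpNormOn d U f p
  set S := triebelSeminorm d U f σ 1 p q 1 with hS
  have hSm := measurable_scaledOsc hU hf σ
  have hWm := measurable_doubledOsc hU hf σ
  set V : ℕ → EuclideanSpace ℝ (Fin d) → ℝ → ℝ≥0∞ := fun k x t =>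
    ballAverage (fun y => scaledOsc U f σ y ((1 / 2) ^ k * t) ^ r) x t ^ (1 / r) with hV
  have hSk : ∀ k : ℕ, Measurable (Function.uncurry fun y t => scaledOsc U f σ y ((1 / 2) ^ k * t)) :=
    fun k => hSm.comp (measurable_fst.prodMk (measurable_snd.const_mul ((1 / 2 : ℝ) ^ k)))
  have hVm : ∀ k, Measurable (Function.uncurry (V k)) := fun k =>
    (measurable_ballAverage (g := fun y t => scaledOsc U f σ y ((1 / 2) ^ k * t) ^ r)
      ((hSk k).pow_const r)).pow_const _
  have hcVm : ∀ k, Measurable (Function.uncurry fun x t => c₂ * θ ^ k * V k x t) := fun k =>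
    (hVm k).const_mul _
  have hsum : Measurable (Function.uncurry fun x t => ∑' k : ℕ, c₂ * θ ^ k * V k x t) :=
    Measurable.tsum hcVm
  have hbsum : Measurable (Function.uncurry fun x t => b * ∑' k : ℕ, c₂ * θ ^ k * V k x t) :=
    hsum.const_mul b
  have hcW : Measurable (Function.uncurry fun x t => c₁ * doubledOsc U f σ x t) :=
    hWm.const_mul c₁
  have hVle : ∀ k, mixedNorm (ENNReal.ofReal p) q unitInvMeasure (V k) ≤ A * S := by
    intro k
    refine (hA unitInvMeasure ae_unitInvMeasure_mem _ (hSk k)).trans (mul_le_mul_right ?_ _)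
    rw [hS, ← mixedNorm_scaledOsc hU hp hq]
    exact mixedNorm_comp_mul_left_le (by positivity) hSm fun x t ht => scaledOsc_of_notMem_right ht
  have hpt : ∀ x, ∀ᵐ t ∂unitInvMeasure,
      U.indicator (fun x => triebelInner d U f σ u x t) x ≤
        D * (c₁ * doubledOsc U f σ x t + b * ∑' k : ℕ, c₂ * θ ^ k * V k x t) := fun x => by
    filter_upwards [ae_unitInvMeasure_mem] with t ht
    by_cases hx : x ∈ U
    · rw [indicator_of_mem hx]
      exact triebelInner_le hU hf hκ0 hκt hκ hr hu hru hlim hx ht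
    · rw [indicator_of_notMem hx]
      exact zero_le
  rw [triebelSeminorm_eq hU hp hq]
  calc mixedNorm (ENNReal.ofReal p) q unitInvMeasure
        (fun x t => U.indicator (fun x => triebelInner d U f σ u x t) x)
      ≤ D * (mixedNorm (ENNReal.ofReal p) q unitInvMeasure (fun x t => c₁ * doubledOsc U f σ x t) +
        mixedNorm (ENNReal.ofReal p) q unitInvMeasure
          (fun x t => b * ∑' k : ℕ, c₂ * θ ^ k * V k x t)) :=
        (mixedNorm_mono (ae_of_all _ hpt)).trans ((mixedNorm_const_mul_le D (hcW.add hbsum)).trans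
          (mul_le_mul_right (mixedNorm_add_le hp' hq hcW hbsum) _))
    _ ≤ D * (c₁ * (E * (S + K * L)) + b * ∑' k : ℕ, c₂ * θ ^ k * (A * S)) := by
        refine mul_le_mul_right (add_le_add ?_ ?_) _
        · refine (mixedNorm_const_mul_le c₁ hWm).trans (mul_le_mul_right ?_ _)
          refine (mixedNorm_doubledOsc_le hU hf hσ hp hq).trans_eq ?_
          rw [← mul_assoc N]
        · refine (mixedNorm_const_mul_le b hsum).trans (mul_le_mul_right ?_ _)
          refine (mixedNorm_tsum_le hp' hq hcVm).trans (ENNReal.tsum_le_tsum fun k => ?_)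
          exact (mixedNorm_const_mul_le _ (hVm k)).trans (mul_le_mul_right (hVle k) _)
    _ = D * (c₁ * (E * (S + K * L)) + b * (c₂ * A * (1 - θ)⁻¹) * S) := by
        have : ∀ k : ℕ, c₂ * θ ^ k * (A * S) = c₂ * A * S * θ ^ k := fun k => by ring
        simp only [this]
        rw [ENNReal.tsum_mul_left, ENNReal.tsum_geometric]
        ring
    _ ≤ D * (c₁ * (E * ((1 + K) * (L + S))) + b * (c₂ * A * (1 - θ)⁻¹) * (L + S)) := by
        have h1 : S + K * L ≤ (1 + K) * (L + S) := by
          calc S + K * L ≤ S + K * L + (L + K * S) := le_self_add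
            _ = _ := by ring
        have h2 : S ≤ L + S := le_add_self
        gcongr
    _ = _ := by ring

end Equivalence

/-- **Equivalence of the averaged norms for different auxiliary indices `u`.**  Let
`Ω ⊊ ℝ^d` be an interior `(ε,δ)`-corkscrew domain, `1 ≤ p < ∞`, `1 ≤ q ≤ ∞`,
`0 < σ < 1` and `1 ≤ u ≤ ∞` with `σ > d/min(p,q) - d/u`.  There are constants
`c, C > 0` depending only on `d, ε, δ, σ, p, q, u` such that for every measurable
`f : Ω → ℝ`,
`c (‖f‖_{L^p(Ω)} + ‖f‖_{Ḟ^{σ,1}_{p,q,1}(Ω)}) ≤ ‖f‖_{L^p(Ω)} + ‖f‖_{Ḟ^{σ,1}_{p,q,u}(Ω)}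
  ≤ C (‖f‖_{L^p(Ω)} + ‖f‖_{Ḟ^{σ,1}_{p,q,1}(Ω)})`. -/
theorem auxiliary_index_equivalence (d : ℕ) (ε δ : ℝ) (hε : 0 < ε) (hδ : 0 < δ)
    (p : ℝ) (hp : 1 ≤ p) (q : ℝ≥0∞) (hq : 1 ≤ q)
    (σ : ℝ) (hσ0 : 0 < σ) (hσ1 : σ < 1) (u : ℝ≥0∞) (hu : 1 ≤ u)
    (hσu : (d : ℝ) / (min (ENNReal.ofReal p) q).toReal - (d : ℝ) / u.toReal < σ) :
    ∃ c C : ℝ, 0 < c ∧ 0 < C ∧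
      ∀ Ω : Set (EuclideanSpace ℝ (Fin d)), IsCorkscrew d ε δ Ω →
        ∀ f : EuclideanSpace ℝ (Fin d) → ℝ, Measurable f →
          ENNReal.ofReal c * (lpNormOn d Ω f p + triebelSeminorm d Ω f σ 1 p q 1) ≤
              lpNormOn d Ω f p + triebelSeminorm d Ω f σ 1 p q u ∧
            lpNormOn d Ω f p + triebelSeminorm d Ω f σ 1 p q u ≤
              ENNReal.ofReal C *
                (lpNormOn d Ω f p + triebelSeminorm d Ω f σ 1 p q 1) := by
  obtain ⟨κ, hκ0, hκt, hκ⟩ := IsCorkscrew.exists_lowerDensity d hε hδ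
  obtain ⟨C, hCt, hC⟩ := triebelSeminorm_le hκ0 hκt hp hq hσ0 hu hσu
  set B := volume (Metric.ball (0 : EuclideanSpace ℝ (Fin d)) 1) ^ (1 - 1 / u.toReal) with hB
  have hBt : B ≠ ⊤ := by
    rw [hB, Ne, ENNReal.rpow_eq_top_iff]
    simp [volume_unit_ball_ne_zero (d := d), volume_unit_ball_ne_top (d := d)]
  have hofReal : ∀ a : ℝ≥0∞, a ≠ ⊤ → ENNReal.ofReal (1 + a.toReal) = 1 + a := fun a ha => by
    rw [ENNReal.ofReal_add zero_le_one toReal_nonneg, ENNReal.ofReal_one, ENNReal.ofReal_toReal ha]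
  have hB1 : 0 < 1 + B.toReal := by positivity
  refine ⟨(1 + B.toReal)⁻¹, 1 + C.toReal, by positivity, by positivity, ?_⟩
  intro Ω hΩ f hf
  have hU : MeasurableSet Ω := hΩ.1.measurableSet
  constructor
  · rw [ENNReal.ofReal_inv_of_pos hB1, hofReal B hBt, ← ENNReal.div_eq_inv_mul]
    refine ENNReal.div_le_of_le_mul' ?_
    calc lpNormOn d Ω f p + triebelSeminorm d Ω f σ 1 p q 1
        ≤ lpNormOn d Ω f p + B * triebelSeminorm d Ω f σ 1 p q u :=
          add_le_add le_rfl (triebelSeminorm_one_le hU hf hp hq hu)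
      _ ≤ lpNormOn d Ω f p + B * triebelSeminorm d Ω f σ 1 p q u +
          (B * lpNormOn d Ω f p + triebelSeminorm d Ω f σ 1 p q u) := le_self_add
      _ = _ := by ring
  · rw [hofReal C hCt]
    by_cases hfp : lpNormOn d Ω f p = ⊤
    · rw [hfp, top_add, top_add, ENNReal.mul_top (by simp)]
    · calc lpNormOn d Ω f p + triebelSeminorm d Ω f σ 1 p q u
          ≤ (lpNormOn d Ω f p + triebelSeminorm d Ω f σ 1 p q 1) +
            C * (lpNormOn d Ω f p + triebelSeminorm d Ω f σ 1 p q 1) :=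
            add_le_add le_self_add (hC Ω hU (hκ Ω hΩ) f hf hfp)
        _ = _ := by ring
end
end

section
/- (Meyers projection: existence and uniqueness.) Let Q ⊂ ℝ^d be an open axis-parallel cube, k ∈ ℕ₀, and let f be k times continuously differentiable on Q with all partial derivatives D^β f (|β| ≤ k) integrable on Q. Then there exists a unique polynomial P ∈ 𝒫^k (real polynomials on ℝ^d of total degree at most k) such that ∫_Q D^β P dm = ∫_Q D^β f dm for every multiindex β ∈ ℕ₀^d with |β| ≤ k. -/
open Set MeasureTheory

noncomputable section

/-- First-order classical partial derivative `∂ᵢ` of a function `ℝ^d → ℝ`. -/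
noncomputable def partialD {d : ℕ} (i : Fin d) (f : (Fin d → ℝ) → ℝ) :
    (Fin d → ℝ) → ℝ :=
  fun x => fderiv ℝ f x (Pi.single i 1)

/-- Iterated classical partial derivative `D^β = ∂₁^{β₁} ⋯ ∂_d^{β_d}` associated to a
multiindex `β ∈ ℕ₀^d`. -/
noncomputable def Dpow {d : ℕ} (β : Fin d → ℕ) (f : (Fin d → ℝ) → ℝ) :
    (Fin d → ℝ) → ℝ :=
  (List.finRange d).foldr (fun i g => (partialD i)^[β i] g) f

/-- The open axis-parallel cube with center `c` and half side-length `r` in `ℝ^d`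
(so the side length is `2r`). -/
def openCube (d : ℕ) (c : Fin d → ℝ) (r : ℝ) : Set (Fin d → ℝ) :=
  {x | ∀ i, |x i - c i| < r}

theorem partialD_eval {d : ℕ} (i : Fin d) (p : MvPolynomial (Fin d) ℝ) :
    partialD i (fun y => MvPolynomial.eval y p) =
      fun y => MvPolynomial.eval y (MvPolynomial.pderiv i p) := by
  have hdiff (q : MvPolynomial (Fin d) ℝ) :
      Differentiable ℝ fun y : Fin d → ℝ => MvPolynomial.eval y q := fun x =>
    (AnalyticOnNhd.eval_mvPolynomial (𝕜 := ℝ) q x (mem_univ x)).differentiableAt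
  funext x
  induction p using MvPolynomial.induction_on with
  | C a => simp [partialD]
  | add p q hp hq =>
    simp only [partialD, map_add] at hp hq ⊢
    rw [fderiv_fun_add (hdiff p x) (hdiff q x), ← hp, ← hq]
    rfl
  | mul_X p j hp =>
    simp only [partialD] at hp ⊢
    have hX : HasFDerivAt (fun y : Fin d → ℝ => y j)
        (ContinuousLinearMap.proj (R := ℝ) (φ := fun _ : Fin d => ℝ) j) x := hasFDerivAt_apply j x
    simp only [map_mul, MvPolynomial.eval_X]
    rw [((hdiff p x).hasFDerivAt.fun_mul hX).fderiv]
    simp [MvPolynomial.pderiv_X, hp, Pi.single_apply, apply_ite]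

/-- The formal counterpart of `Dpow` on polynomials, along a list of variables. -/
def iteratedPDeriv {d : ℕ} (l : List (Fin d)) (β : Fin d → ℕ) :
    Module.End ℝ (MvPolynomial (Fin d) ℝ) :=
  (l.map fun i => ((MvPolynomial.pderiv i).toLinearMap : Module.End ℝ _) ^ β i).prod

theorem iterate_partialD_eval {d : ℕ} (i : Fin d) (n : ℕ) (p : MvPolynomial (Fin d) ℝ) :
    (partialD i)^[n] (fun y => MvPolynomial.eval y p) =
      fun y => MvPolynomial.eval y
        ((((MvPolynomial.pderiv i).toLinearMap : Module.End ℝ _) ^ n) p) := by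
  induction n with
  | zero => rfl
  | succ n ih =>
    rw [Function.iterate_succ_apply', ih, partialD_eval, pow_succ']
    rfl

theorem Dpow_eval {d : ℕ} (β : Fin d → ℕ) (p : MvPolynomial (Fin d) ℝ) :
    Dpow β (fun y => MvPolynomial.eval y p) =
      fun y => MvPolynomial.eval y (iteratedPDeriv (List.finRange d) β p) := by
  unfold Dpow
  induction List.finRange d with
  | nil => rfl
  | cons i l ih =>
    rw [List.foldr_cons, ih, iterate_partialD_eval]
    rfl

theorem coeff_pderiv_pow {d : ℕ} (i : Fin d) (n : ℕ) (m : Fin d →₀ ℕ) :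
    ∃ a : ℝ, a ≠ 0 ∧ ∀ p : MvPolynomial (Fin d) ℝ,
      ((((MvPolynomial.pderiv i).toLinearMap : Module.End ℝ _) ^ n) p).coeff m =
        a * p.coeff (m + Finsupp.single i n) := by
  induction n with
  | zero => exact ⟨1, one_ne_zero, fun p => by simp⟩
  | succ n ih =>
    obtain ⟨a, ha, h⟩ := ih
    refine ⟨a * (((m + Finsupp.single i n) i : ℕ) + 1), mul_ne_zero ha (by positivity),
      fun p => ?_⟩
    rw [pow_succ, Module.End.mul_apply, h]
    simp only [Derivation.coeFn_coe, MvPolynomial.coeff_pderiv, add_assoc, ← Finsupp.single_add]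
    push_cast
    ring

theorem coeff_iteratedPDeriv_list {d : ℕ} (l : List (Fin d)) (β : Fin d → ℕ) (m : Fin d →₀ ℕ) :
    ∃ a : ℝ, a ≠ 0 ∧ ∀ p : MvPolynomial (Fin d) ℝ,
      (iteratedPDeriv l β p).coeff m =
        a * p.coeff (m + (l.map fun i => Finsupp.single i (β i)).sum) := by
  induction l generalizing m with
  | nil => exact ⟨1, one_ne_zero, fun p => by simp [iteratedPDeriv]⟩
  | cons i l ih =>
    obtain ⟨a, ha, h⟩ := coeff_pderiv_pow i (β i) m
    obtain ⟨b, hb, h'⟩ := ih (m + Finsupp.single i (β i))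
    refine ⟨a * b, mul_ne_zero ha hb, fun p => ?_⟩
    change ((((MvPolynomial.pderiv i).toLinearMap : Module.End ℝ _) ^ β i)
      (iteratedPDeriv l β p)).coeff m = _
    rw [h, h', List.map_cons, List.sum_cons, mul_assoc, add_assoc]

theorem coeff_iteratedPDeriv {d : ℕ} (β m : Fin d →₀ ℕ) :
    ∃ a : ℝ, a ≠ 0 ∧ ∀ p : MvPolynomial (Fin d) ℝ,
      (iteratedPDeriv (List.finRange d) β p).coeff m = a * p.coeff (m + β) := by
  convert! coeff_iteratedPDeriv_list (List.finRange d) β m using 8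
  rw [← List.ofFn_eq_map, List.sum_ofFn, Finsupp.univ_sum_single]

theorem exists_iteratedPDeriv_eq_C {d : ℕ} {p : MvPolynomial (Fin d) ℝ} {β : Fin d →₀ ℕ}
    (hβ : β ∈ p.support) (htop : β.degree = p.totalDegree) :
    ∃ a : ℝ, a ≠ 0 ∧ iteratedPDeriv (List.finRange d) β p = MvPolynomial.C a := by
  obtain ⟨a, ha, h⟩ := coeff_iteratedPDeriv β 0
  refine ⟨a * p.coeff β, mul_ne_zero ha (MvPolynomial.mem_support_iff.mp hβ), ?_⟩
  ext m
  rw [MvPolynomial.coeff_C]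
  split_ifs with hm
  · rw [← hm, h, zero_add]
  · obtain ⟨b, -, h'⟩ := coeff_iteratedPDeriv β m
    rw [h', MvPolynomial.coeff_eq_zero_of_totalDegree_lt, mul_zero]
    have hpos : 0 < m.degree := by
      rw [pos_iff_ne_zero, Ne, Finsupp.degree_eq_zero_iff]
      exact Ne.symm hm
    change _ < (m + β).degree
    rw [map_add]
    omega

theorem openCube_eq_ball {d : ℕ} (c : Fin d → ℝ) {r : ℝ} (hr : 0 < r) :
    openCube d c r = Metric.ball c r := by
  ext x
  simp [openCube, dist_pi_lt_iff hr, Real.dist_eq]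

theorem integrableOn_eval_ball {d : ℕ} (c : Fin d → ℝ) (r : ℝ) (p : MvPolynomial (Fin d) ℝ) :
    IntegrableOn (fun x => MvPolynomial.eval x p) (Metric.ball c r) :=
  ((MvPolynomial.continuous_eval p).continuousOn.integrableOn_compact
    (isCompact_closedBall c r)).mono_set Metric.ball_subset_closedBall

/-- The integral over a ball, as a linear functional on polynomials. -/
def ballIntegral {d : ℕ} (c : Fin d → ℝ) (r : ℝ) : MvPolynomial (Fin d) ℝ →ₗ[ℝ] ℝ where
  toFun p := ∫ x in Metric.ball c r, MvPolynomial.eval x p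
  map_add' p q := by
    simp only [map_add]
    exact integral_add (integrableOn_eval_ball c r p) (integrableOn_eval_ball c r q)
  map_smul' a p := by
    simp only [MvPolynomial.smul_eval, integral_const_mul, RingHom.id_apply, smul_eq_mul]

/-- The vector of integral moments of the derivatives of order at most `k`. -/
def derivativeMoments {d : ℕ} (k : ℕ) (c : Fin d → ℝ) (r : ℝ) :
    MvPolynomial.restrictTotalDegree (Fin d) ℝ k →ₗ[ℝ]
      ({n : Fin d →₀ ℕ | (n.sum fun _ e => e) ≤ k} → ℝ) :=
  LinearMap.pi fun β => ballIntegral c r ∘ₗ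
    iteratedPDeriv (List.finRange d) (β : Fin d →₀ ℕ) ∘ₗ Submodule.subtype _

theorem derivativeMoments_injective {d : ℕ} (k : ℕ) (c : Fin d → ℝ) {r : ℝ} (hr : 0 < r) :
    Function.Injective (derivativeMoments k c r) := by
  rw [← LinearMap.ker_eq_bot, LinearMap.ker_eq_bot']
  rintro ⟨p, hp⟩ h
  rw [MvPolynomial.mem_restrictTotalDegree] at hp
  by_contra hne
  have hp0 : p ≠ 0 := fun h0 => hne (Subtype.ext h0)
  obtain ⟨β, hβ, htop⟩ := Finset.exists_mem_eq_sup p.support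
    (MvPolynomial.support_nonempty.mpr hp0) (fun s => s.sum fun _ e => e)
  obtain ⟨a, ha, hD⟩ := exists_iteratedPDeriv_eq_C hβ htop.symm
  have hint : ∫ x in Metric.ball c r,
      MvPolynomial.eval x (iteratedPDeriv (List.finRange d) β p) = 0 :=
    congrFun h ⟨β, (MvPolynomial.le_totalDegree hβ).trans hp⟩
  have hvol : volume.real (Metric.ball c r) ≠ 0 :=
    (ENNReal.toReal_pos (Metric.measure_ball_pos volume c hr).ne'
      measure_ball_lt_top.ne).ne'
  simp [hD, ha, hvol] at hint

theorem derivativeMoments_bijective {d : ℕ} (k : ℕ) (c : Fin d → ℝ) {r : ℝ} (hr : 0 < r) :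
    Function.Bijective (derivativeMoments k c r) := by
  have : Finite {n : Fin d →₀ ℕ | (n.sum fun _ e => e) ≤ k} := Finsupp.finite_of_degree_le k
  have := Fintype.ofFinite {n : Fin d →₀ ℕ | (n.sum fun _ e => e) ≤ k}
  let b : Module.Basis _ ℝ (MvPolynomial.restrictTotalDegree (Fin d) ℝ k) :=
    MvPolynomial.basisRestrictSupport ℝ {n : Fin d →₀ ℕ | (n.sum fun _ e => e) ≤ k}
  have := Module.Finite.of_basis b
  have hinj := derivativeMoments_injective k c hr
  refine ⟨hinj, (LinearMap.injective_iff_surjective_of_finrank_eq_finrank ?_).mp hinj⟩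
  rw [Module.finrank_eq_card_basis b, Module.finrank_fintype_fun_eq_card]

/-- **Meyers projection: existence and uniqueness.**  Let `Q ⊂ ℝ^d` be an open
axis-parallel cube and let `f` be `k` times continuously differentiable on `Q` with
all partial derivatives `D^β f` (`|β| ≤ k`) integrable on `Q`.  Then there exists a
unique polynomial `P` of total degree at most `k` such that
`∫_Q D^β P = ∫_Q D^β f` for every multiindex `β` with `|β| ≤ k`. -/
theorem meyers_projection_exists_unique (d k : ℕ) (c : Fin d → ℝ) (r : ℝ)
    (hr : 0 < r) (f : (Fin d → ℝ) → ℝ)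
    (hf : ContDiffOn ℝ k f (openCube d c r))
    (hint : ∀ β : Fin d → ℕ, (∑ i, β i) ≤ k →
      IntegrableOn (Dpow β f) (openCube d c r) volume) :
    ∃! P : MvPolynomial (Fin d) ℝ, P.totalDegree ≤ k ∧
      ∀ β : Fin d → ℕ, (∑ i, β i) ≤ k →
        (∫ x in openCube d c r, Dpow β (fun y => MvPolynomial.eval y P) x) =
          ∫ x in openCube d c r, Dpow β f x := by
  have hmoment (p : MvPolynomial.restrictTotalDegree (Fin d) ℝ k) (v : (Fin d → ℕ) → ℝ) :
      (∀ β : Fin d → ℕ, (∑ i, β i) ≤ k →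
        (∫ x in openCube d c r, Dpow β (fun y => MvPolynomial.eval y p.1) x) = v β) ↔
      derivativeMoments k c r p = fun β => v β.1 := by
    have hsum (β : Fin d →₀ ℕ) : (β.sum fun _ e => e) = ∑ i, β i :=
      Finsupp.sum_fintype β _ fun _ => rfl
    simp only [Dpow_eval, openCube_eq_ball c hr]
    refine ⟨fun h => funext fun β => h β ((hsum β).symm.trans_le β.2), fun h β hβ => ?_⟩
    exact congrFun h ⟨Finsupp.equivFunOnFinite.symm β, (hsum _).trans_le hβ⟩
  obtain ⟨p, hp, huniq⟩ := (derivativeMoments_bijective k c hr).existsUnique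
    fun β => ∫ x in openCube d c r, Dpow β.1 f x
  refine ⟨p, ⟨(MvPolynomial.mem_restrictTotalDegree _ _ _).mp p.2, (hmoment p _).mpr hp⟩, ?_⟩
  rintro q ⟨hq, hqD⟩
  have hq' := (MvPolynomial.mem_restrictTotalDegree _ _ _).mpr hq
  exact congrArg Subtype.val (huniq ⟨q, hq'⟩
    ((hmoment ⟨q, hq'⟩ fun β => ∫ x in openCube d c r, Dpow β f x).mp hqD))
end
end
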